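/- arXiv:1908.07383 — 2 statements merged into one kernel-verified Lean document; each statement's English description precedes it below -/
import Mathlib

section
/- Let f be a transcendental self-map of ℂ*. Then the escaping set I(f) is either connected or it has infinitely many connected components. -/
open Complex Topology Filter Set Function OnePoint

noncomputable section

/-- The chordal (spherical) distance on the Riemann sphere, restricted to finite points. -/
def chordalDist (z w : ℂ) : ℝ :=
  ‖z - w‖ / Real.sqrt ((1 + ‖z‖ ^ 2) * (1 + ‖w‖ ^ 2))

/-- A transcendental self-map of `ℂ* = ℂ \ {0}`: a holomorphic self-map of the punctured
plane with essential singularities at `0` and `∞`; equivalently, on `ℂ*` it has the form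
`z ^ m * exp (g z + h z⁻¹)` for some `m : ℤ` and nonconstant entire functions `g, h`. -/
def IsTranscendentalSelfMapCStar (f : ℂ → ℂ) : Prop :=
  ∃ (m : ℤ) (g h : ℂ → ℂ),
    Differentiable ℂ g ∧ Differentiable ℂ h ∧
    (¬ ∃ c : ℂ, ∀ z, g z = c) ∧ (¬ ∃ c : ℂ, ∀ z, h z = c) ∧
    ∀ z : ℂ, z ≠ 0 → f z = z ^ m * Complex.exp (g z + h z⁻¹)

/-- The escaping set `I(f)` of a self-map of the punctured plane: points whose orbit
accumulates only at `0` and `∞`. -/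
def escapingSet (f : ℂ → ℂ) : Set ℂ :=
  {z | z ≠ 0 ∧ ∀ ε : ℝ, 0 < ε → ∃ N : ℕ, ∀ n ≥ N,
    ‖f^[n] z‖ < ε ∨ 1 / ε < ‖f^[n] z‖}

/-- The little escaping set `I_e(f)` with essential itinerary `e` (where `true` stands for the
symbol `∞` and `false` for the symbol `0`). -/
def littleEscapingSet (f : ℂ → ℂ) (e : ℕ → Bool) : Set ℂ :=
  {z | z ∈ escapingSet f ∧ ∃ ℓ k : ℕ, ∀ n : ℕ,
    (1 < ‖f^[n + ℓ] z‖ ↔ e (n + k) = true)}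

/-- The immediate little escaping set `Ĩ_e(f)`. -/
def immediateLittleEscapingSet (f : ℂ → ℂ) (e : ℕ → Bool) : Set ℂ :=
  {z | z ∈ escapingSet f ∧ ∃ ℓ : ℕ, ∀ n : ℕ,
    (1 < ‖f^[n + ℓ] z‖ ↔ e (n + ℓ) = true)}

/-- The Fatou set of a self-map of the punctured plane: points of `ℂ*` with a neighbourhood
(inside `ℂ*`) on which the family of iterates is equicontinuous w.r.t. the chordal metric. -/
def FatouSet (f : ℂ → ℂ) : Set ℂ :=
  {z | z ≠ 0 ∧ ∃ U : Set ℂ, IsOpen U ∧ z ∈ U ∧ (∀ w ∈ U, w ≠ 0) ∧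
    ∀ w ∈ U, ∀ ε : ℝ, 0 < ε → ∃ δ : ℝ, 0 < δ ∧ ∀ w' ∈ U,
      chordalDist w w' < δ → ∀ n : ℕ, chordalDist (f^[n] w) (f^[n] w') < ε}

/-- The Julia set `J(f) = ℂ* \ F(f)`. -/
def JuliaSet (f : ℂ → ℂ) : Set ℂ := {z : ℂ | z ≠ 0} \ FatouSet f

/-- A Fatou component: a connected component of the Fatou set. -/
def IsFatouComponent (f : ℂ → ℂ) (U : Set ℂ) : Prop :=
  ∃ z ∈ FatouSet f, U = connectedComponentIn (FatouSet f) z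

/-- A wandering domain: a Fatou component `U` such that the Fatou components containing the
iterated images `fⁿ(U)` are pairwise distinct. -/
def IsWanderingDomain (f : ℂ → ℂ) (U : Set ℂ) : Prop :=
  IsFatouComponent f U ∧ ∃ V : ℕ → Set ℂ, V 0 = U ∧
    (∀ n, IsFatouComponent f (V n)) ∧
    (∀ n, f '' V n ⊆ V (n + 1)) ∧ Function.Injective V

/-- A set is bounded in `ℂ*` if it lies in some closed annulus `{r ≤ |z| ≤ R}`. -/
def BoundedInCStar (X : Set ℂ) : Prop :=
  ∃ r R : ℝ, 0 < r ∧ r ≤ R ∧ X ⊆ {z : ℂ | r ≤ ‖z‖ ∧ ‖z‖ ≤ R}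

/-- The boundary of a subset of `ℂ*` taken in `ℂ*`. -/
def boundaryInCStar (G : Set ℂ) : Set ℂ := frontier G \ {0}

/-- The set `I(f) ∪ {0, ∞}` regarded as a subset of the Riemann sphere `ℂ̂ = ℂ ∪ {∞}`. -/
def escapingSphere (f : ℂ → ℂ) : Set (OnePoint ℂ) :=
  ((fun z : ℂ => (z : OnePoint ℂ)) '' escapingSet f) ∪ {((0 : ℂ) : OnePoint ℂ), ∞}

/-- The set `I_e(f) ∪ {0, ∞}` regarded as a subset of the Riemann sphere. -/
def littleEscapingSphere (f : ℂ → ℂ) (e : ℕ → Bool) : Set (OnePoint ℂ) :=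
  ((fun z : ℂ => (z : OnePoint ℂ)) '' littleEscapingSet f e) ∪ {((0 : ℂ) : OnePoint ℂ), ∞}

/-- A subset of the sphere has exactly two connected components. -/
def HasExactlyTwoComponents (K : Set (OnePoint ℂ)) : Prop :=
  ∃ x ∈ K, ∃ y ∈ K, connectedComponentIn K x ≠ connectedComponentIn K y ∧
    ∀ z ∈ K, connectedComponentIn K z = connectedComponentIn K x ∨
      connectedComponentIn K z = connectedComponentIn K y

/-- A domain `U ⊆ ℂ*` is doubly connected if its complement in the Riemann sphere has
exactly two connected components. -/
def DoublyConnected (U : Set ℂ) : Prop :=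
  HasExactlyTwoComponents (((fun z : ℂ => (z : OnePoint ℂ)) '' U)ᶜ)

/-- A transcendental entire function. -/
def IsTranscendentalEntire (f : ℂ → ℂ) : Prop :=
  Differentiable ℂ f ∧ ¬ ∃ p : Polynomial ℂ, ∀ z, f z = p.eval z

/-- The Fatou set of an entire function. -/
def FatouSetEntire (f : ℂ → ℂ) : Set ℂ :=
  {z | ∃ U : Set ℂ, IsOpen U ∧ z ∈ U ∧
    ∀ w ∈ U, ∀ ε : ℝ, 0 < ε → ∃ δ : ℝ, 0 < δ ∧ ∀ w' ∈ U,
      chordalDist w w' < δ → ∀ n : ℕ, chordalDist (f^[n] w) (f^[n] w') < ε}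

/-- The Julia set of an entire function. -/
def JuliaSetEntire (f : ℂ → ℂ) : Set ℂ := (FatouSetEntire f)ᶜ

/-- `f` has a finite asymptotic value. -/
def HasFiniteAsymptoticValue (f : ℂ → ℂ) : Prop :=
  ∃ (a : ℂ) (γ : ℝ → ℂ), ContinuousOn γ (Set.Ici (0 : ℝ)) ∧
    Tendsto (fun t => ‖γ t‖) atTop atTop ∧
    Tendsto (fun t => f (γ t)) atTop (nhds a)

open Metric in
/-- A quantitative form of Bloch's theorem, with control of the derivative on the disc which is
mapped over a large disc. -/
theorem exists_closedBall_deriv_le_and_subset_image {f : ℂ → ℂ} {c : ℂ} {r R : ℝ}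
    (hf : DifferentiableOn ℂ f (ball c R)) (hr : 0 < r) (hrR : r < R) (hc : deriv f c ≠ 0) :
    ∃ a s, 0 < s ∧ closedBall a s ⊆ closedBall c r ∧
      (∀ z ∈ closedBall a s, ‖deriv f c‖ / 2 ≤ ‖deriv f z‖) ∧
      closedBall (f a) (r * ‖deriv f c‖ / 100) ⊆ f '' closedBall a s := by
  have hsub : closedBall c r ⊆ ball c R := closedBall_subset_ball hrR
  have hdf : DifferentiableOn ℂ (deriv f) (ball c R) := hf.deriv isOpen_ball
  obtain ⟨a, ha, hmax⟩ := (isCompact_closedBall c r).exists_isMaxOn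
    (f := fun z => (r - dist z c) * ‖deriv f z‖) ⟨c, mem_closedBall_self hr.le⟩
    (by
      refine ContinuousOn.mul (by fun_prop) ?_
      exact (hdf.continuousOn.mono hsub).norm)
  have hmax' : ∀ z ∈ closedBall c r,
      (r - dist z c) * ‖deriv f z‖ ≤ (r - dist a c) * ‖deriv f a‖ := fun z hz => hmax hz
  have hcpos : 0 < ‖deriv f c‖ := norm_pos_iff.2 hc
  have h0 : r * ‖deriv f c‖ ≤ (r - dist a c) * ‖deriv f a‖ := by
    simpa using hmax' c (mem_closedBall_self hr.le)
  have hac : 0 ≤ r - dist a c := sub_nonneg.2 (mem_closedBall.1 ha)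
  set M := ‖deriv f a‖ with hM
  have hpos : 0 < (r - dist a c) * M := lt_of_lt_of_le (mul_pos hr hcpos) h0
  have hMpos : 0 < M := pos_of_mul_pos_right hpos hac
  set t := (r - dist a c) / 2 with ht
  have htpos : 0 < t := by
    have := pos_of_mul_pos_left hpos hMpos.le
    positivity
  have hMc : ‖deriv f c‖ ≤ M := by
    have : r * ‖deriv f c‖ ≤ r * M :=
      h0.trans (mul_le_mul_of_nonneg_right (by linarith [dist_nonneg (x := a) (y := c)]) hMpos.le)
    exact le_of_mul_le_mul_left this hr
  have hballt : closedBall a t ⊆ closedBall c r :=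
    closedBall_subset_closedBall' (by rw [ht]; linarith)
  have hbound : ∀ z ∈ closedBall a t, ‖deriv f z‖ ≤ 2 * M := by
    intro z hz
    have h1 := hmax' z (hballt hz)
    have h2 : t ≤ r - dist z c := by
      have := dist_triangle z a c
      have := mem_closedBall.1 hz
      rw [ht] at *; linarith
    have h3 : t * ‖deriv f z‖ ≤ t * (2 * M) :=
      (mul_le_mul_of_nonneg_right h2 (norm_nonneg _)).trans (h1.trans (by rw [ht]; linarith))
    exact le_of_mul_le_mul_left h3 htpos
  have hlip : ∀ z ∈ ball a t, dist (deriv f z) (deriv f a) ≤ 3 * M / t * dist z a := by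
    intro z hz
    refine Complex.dist_le_div_mul_dist_of_mapsTo_ball
      (hdf.mono ((ball_subset_closedBall.trans hballt).trans hsub)) ?_ hz
    intro y hy
    rw [mem_closedBall, dist_eq_norm]
    have := norm_sub_le (deriv f y) (deriv f a)
    have := hbound y (ball_subset_closedBall hy)
    linarith
  set s := t / 8 with hs
  have hspos : 0 < s := by positivity
  have hst : closedBall a s ⊆ ball a t := closedBall_subset_ball (by rw [hs]; linarith)
  have hsR : closedBall a s ⊆ ball c R :=
    (hst.trans ball_subset_closedBall).trans (hballt.trans hsub)
  have hclose : ∀ z ∈ closedBall a s, ‖deriv f z - deriv f a‖ ≤ M / 2 := by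
    intro z hz
    rw [← dist_eq_norm]
    refine (hlip z (hst hz)).trans ?_
    have h1 : dist z a ≤ t / 8 := mem_closedBall.1 hz
    calc 3 * M / t * dist z a ≤ 3 * M / t * (t / 8) := by gcongr
      _ = 3 / 8 * M := by field_simp
      _ ≤ M / 2 := by linarith
  have hdiff : ∀ z ∈ closedBall a s, DifferentiableAt ℂ f z := fun z hz =>
    hf.differentiableAt (isOpen_ball.mem_nhds (hsR hz))
  refine ⟨a, s, hspos, (hst.trans ball_subset_closedBall).trans hballt, fun z hz => ?_, ?_⟩
  · have h1 := hclose z hz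
    have h2 := norm_sub_norm_le (deriv f a) (deriv f z)
    rw [norm_sub_rev] at h2
    linarith
  · have hlow : ∀ z ∈ closedBall a s, M / 2 * ‖z - a‖ ≤ ‖f z - f a‖ := by
      intro z hz
      have h1 := (convex_closedBall a s).norm_image_sub_le_of_norm_hasDerivWithin_le
        (f := fun z => f z - deriv f a * z) (f' := fun z => deriv f z - deriv f a) (C := M / 2)
        (fun x hx => ((hdiff x hx).hasDerivAt.sub
          (by simpa using (hasDerivAt_id x).const_mul (deriv f a))).hasDerivWithinAt)
        hclose (mem_closedBall_self hspos.le) hz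
      have h2 : f z - deriv f a * z - (f a - deriv f a * a) =
        (f z - f a) - deriv f a * (z - a) := by ring
      rw [h2] at h1
      have h3 := norm_sub_norm_le (deriv f a * (z - a)) (f z - f a)
      rw [norm_sub_rev (deriv f a * (z - a)), norm_mul, ← hM] at h3
      linarith
    have himage : ball (f a) (M / 2 * s / 2) ⊆ f '' closedBall a s := by
      refine DiffContOnCl.ball_subset_image_closedBall
        (DifferentiableOn.diffContOnCl ?_) hspos ?_ ?_
      · rw [closure_ball a hspos.ne']
        exact hf.mono hsR
      · intro z hz
        have := hlow z (sphere_subset_closedBall hz)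
        rwa [mem_sphere_iff_norm.1 hz] at this
      · have h1 : ∀ᶠ z in 𝓝[≠] a, f z ≠ f a := by
          have hmem : ∀ᶠ z in 𝓝[≠] a, z ∈ closedBall a s :=
            mem_nhdsWithin_of_mem_nhds (closedBall_mem_nhds a hspos)
          filter_upwards [hmem, self_mem_nhdsWithin] with z hz hza heq
          have h2 := hlow z hz
          rw [heq, sub_self, norm_zero] at h2
          have : 0 < ‖z - a‖ := norm_pos_iff.2 (sub_ne_zero.2 hza)
          have : 0 < M / 2 * ‖z - a‖ := by positivity
          linarith
        exact h1.frequently.filter_mono nhdsWithin_le_nhds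
    refine (closedBall_subset_ball ?_).trans himage
    have h1 : M / 2 * s / 2 = ((r - dist a c) * M) / 64 := by rw [hs, ht]; ring
    rw [h1]
    have := mul_pos hr hcpos
    linarith

/-- Growth of `g z + h z⁻¹` relative to itself and to `log ‖z‖` on large circles. -/
theorem exists_norm_eq_lt_norm_sub {g h : ℂ → ℂ} (hg : Differentiable ℂ g)
    (hh : Differentiable ℂ h) (hgc : ¬ ∃ c : ℂ, ∀ z, g z = c) {T : ℝ} (hT : 0 ≤ T) :
    ∃ R : ℝ, 1 ≤ R ∧ ∀ z₀ : ℂ, R ≤ ‖z₀‖ → ∃ z : ℂ, ‖z‖ = ‖z₀‖ ∧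
      1 / 4 * (T * (1 + Real.log ‖z₀‖) + ‖g z₀ + h z₀⁻¹‖) <
        ‖(g z + h z⁻¹) - (g z₀ + h z₀⁻¹)‖ := by
  obtain ⟨z₁, hz₁⟩ : ∃ z₁, deriv g z₁ ≠ 0 := by
    by_contra! hcon
    exact hgc ⟨g 0, fun z => is_const_of_deriv_eq_zero hg hcon z 0⟩
  obtain ⟨H, hH⟩ := (isCompact_closedBall (0 : ℂ) 1).exists_bound_of_continuousOn
    hh.continuous.continuousOn
  have hH0 : 0 ≤ H := (norm_nonneg _).trans (hH 0 (by simp))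
  set A := ‖g 0‖ + 2 * (1 / 4 * T + 3 * H) with hA
  have hlim : Tendsto (fun r : ℝ => (A + T / 2 * Real.log r) - ‖deriv g z₁‖ * (r - ‖z₁‖))
      atTop atBot := by
    have h1 : (fun r : ℝ => (A + ‖deriv g z₁‖ * ‖z₁‖) + T / 2 * Real.log r) =o[atTop]
        (fun r : ℝ => ‖deriv g z₁‖ * r) := by
      refine Asymptotics.IsLittleO.const_mul_right (norm_ne_zero_iff.2 hz₁) ?_
      refine Asymptotics.IsLittleO.add ?_ (Real.isLittleO_log_id_atTop.const_mul_left _)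
      exact Asymptotics.isLittleO_const_left.2
        (Or.inr (tendsto_norm_atTop_atTop.comp tendsto_id))
    have h2 : Tendsto (fun r : ℝ => ‖deriv g z₁‖ * r) atTop atTop :=
      tendsto_id.const_mul_atTop (norm_pos_iff.2 hz₁)
    have h3 : ∀ᶠ r : ℝ in atTop, (A + T / 2 * Real.log r) - ‖deriv g z₁‖ * (r - ‖z₁‖) ≤
        -(1 / 2 * (‖deriv g z₁‖ * r)) := by
      filter_upwards [h1.def (c := 1 / 2) (by norm_num), eventually_ge_atTop 0] with r hr hr0
      have h4 := (le_abs_self _).trans hr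
      rw [Real.norm_eq_abs, abs_of_nonneg (by positivity)] at h4
      linarith
    exact tendsto_atBot_mono' _ h3
      (tendsto_neg_atTop_atBot.comp (h2.const_mul_atTop (by norm_num)))
  obtain ⟨R, hR⟩ := eventually_atTop.1
    ((hlim.eventually_lt_atBot 0).and (eventually_gt_atTop (max 1 ‖z₁‖)))
  refine ⟨max R 1, le_max_right _ _, fun z₀ hz₀ => ?_⟩
  by_contra! hcon
  set r := ‖z₀‖ with hr
  obtain ⟨hr1, hr2⟩ := hR r ((le_max_left _ _).trans hz₀)
  have hr3 : 1 < r := (le_max_left _ _).trans_lt hr2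
  have hr4 : ‖z₁‖ < r := (le_max_right _ _).trans_lt hr2
  have hr0 : 0 < r := by linarith
  have hh' : ∀ z : ℂ, ‖z‖ = r → ‖h z⁻¹‖ ≤ H := fun z hz =>
    hH _ (by simpa [hz] using inv_le_one_of_one_le₀ hr3.le)
  set S := 1 / 4 * T * (1 + Real.log r) + 3 * H with hS
  have hcirc : ∀ z : ℂ, ‖z‖ = r → ‖g z - g z₀‖ ≤ 1 / 4 * ‖g z₀‖ + S := by
    intro z hz
    have h1 := hcon z hz
    have h2 : g z - g z₀ = ((g z + h z⁻¹) - (g z₀ + h z₀⁻¹)) - (h z⁻¹ - h z₀⁻¹) := by ring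
    have h3 := norm_sub_le ((g z + h z⁻¹) - (g z₀ + h z₀⁻¹)) (h z⁻¹ - h z₀⁻¹)
    have h4 := norm_sub_le (h z⁻¹) (h z₀⁻¹)
    have h5 := norm_add_le (g z₀) (h z₀⁻¹)
    have h6 := hh' z hz
    have h7 := hh' z₀ rfl
    rw [h2, hS]
    linarith
  have hdisc : ∀ z ∈ Metric.closedBall (0 : ℂ) r, ‖g z - g z₀‖ ≤ 1 / 4 * ‖g z₀‖ + S := by
    intro z hz
    refine Complex.norm_le_of_forall_mem_frontier_norm_le (f := fun z => g z - g z₀)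
      (Metric.isBounded_ball (x := (0 : ℂ)) (r := r))
      (hg.sub_const _).diffContOnCl ?_ (by rwa [closure_ball _ hr0.ne'])
    intro y hy
    rw [frontier_ball _ hr0.ne', mem_sphere_zero_iff_norm] at hy
    exact hcirc y hy
  have hS' : 1 / 4 * ‖g z₀‖ + S ≤ A + T / 2 * Real.log r := by
    have h1 := hdisc 0 (Metric.mem_closedBall_self hr0.le)
    have h2 := norm_sub_norm_le (g z₀) (g 0)
    rw [norm_sub_rev] at h2
    have h3 : 0 ≤ T * Real.log r := mul_nonneg hT (Real.log_nonneg hr3.le)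
    have h4 := norm_nonneg (g 0)
    rw [hA, hS] at *
    linarith
  have hcauchy : ‖deriv (fun z => g z - g z₀) z₁‖ ≤ (A + T / 2 * Real.log r) / (r - ‖z₁‖) := by
    refine Complex.norm_deriv_le_of_forall_mem_sphere_norm_le (by linarith)
      (hg.sub_const _).diffContOnCl fun z hz => (hdisc z ?_).trans hS'
    have h1 := norm_sub_norm_le z z₁
    rw [mem_sphere_iff_norm.1 hz] at h1
    rw [mem_closedBall_zero_iff]
    linarith
  rw [deriv_sub_const, le_div_iff₀ (by linarith)] at hcauchy
  linarith

/-- Every point of the circle of radius `exp c.re` has a logarithm at distance at most `π`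
from `c`. -/
theorem exists_exp_eq_re_eq {z c : ℂ} (hz : ‖z‖ = Real.exp c.re) :
    ∃ w : ℂ, Complex.exp w = z ∧ w.re = c.re ∧ ‖w - c‖ ≤ Real.pi := by
  refine ⟨c + (z / Complex.exp c).arg * I, ?_, by simp, ?_⟩
  · have h1 : ‖z / Complex.exp c‖ = 1 := by
      rw [norm_div, Complex.norm_exp, hz, div_self (Real.exp_ne_zero _)]
    have h2 := Complex.norm_mul_exp_arg_mul_I (z / Complex.exp c)
    rw [h1, ofReal_one, one_mul] at h2
    rw [Complex.exp_add, h2, mul_div_cancel₀ _ (Complex.exp_ne_zero c)]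
  · simpa using Complex.abs_arg_le_pi _

/-- Oscillation of `g (exp w) + h (exp (-w))` along vertical segments far from the imaginary
axis. -/
theorem exists_re_eq_lt_norm_sub {g h : ℂ → ℂ} (hg : Differentiable ℂ g)
    (hh : Differentiable ℂ h) (hgc : ¬ ∃ c : ℂ, ∀ z, g z = c) (hhc : ¬ ∃ c : ℂ, ∀ z, h z = c)
    {T : ℝ} (hT : 0 ≤ T) :
    ∃ X : ℝ, ∀ c : ℂ, X ≤ |c.re| → ∃ w : ℂ, w.re = c.re ∧ ‖w - c‖ ≤ Real.pi ∧
      1 / 4 * (T * (1 + |c.re|) + ‖g (exp c) + h (exp (-c))‖) <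
        ‖(g (exp w) + h (exp (-w))) - (g (exp c) + h (exp (-c)))‖ := by
  obtain ⟨R₁, hR₁, H₁⟩ := exists_norm_eq_lt_norm_sub hg hh hgc hT
  obtain ⟨R₂, hR₂, H₂⟩ := exists_norm_eq_lt_norm_sub hh hg hhc hT
  refine ⟨max (Real.log R₁) (Real.log R₂), fun c hc => ?_⟩
  rcases le_total 0 c.re with h0 | h0
  · rw [abs_of_nonneg h0] at hc ⊢
    have hR : R₁ ≤ ‖exp c‖ := by
      rw [Complex.norm_exp, ← Real.log_le_iff_le_exp (by linarith)]
      exact (le_max_left _ _).trans hc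
    obtain ⟨z, hz, hlt⟩ := H₁ _ hR
    obtain ⟨w, rfl, hw, hwc⟩ := exists_exp_eq_re_eq (hz.trans (Complex.norm_exp c))
    refine ⟨w, hw, hwc, ?_⟩
    rwa [Complex.norm_exp, Real.log_exp, ← Complex.exp_neg, ← Complex.exp_neg] at hlt
  · rw [abs_of_nonpos h0] at hc ⊢
    have hR : R₂ ≤ ‖exp (-c)‖ := by
      rw [Complex.norm_exp, ← Real.log_le_iff_le_exp (by linarith)]
      exact (le_max_right _ _).trans (by simpa using hc)
    obtain ⟨z, hz, hlt⟩ := H₂ _ hR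
    obtain ⟨w, rfl, hw, hwc⟩ := exists_exp_eq_re_eq (hz.trans (Complex.norm_exp (-c)))
    refine ⟨-w, by simp [hw], by rw [← norm_neg]; simpa [add_comm, sub_eq_add_neg] using hwc, ?_⟩
    rw [Complex.norm_exp, Real.log_exp, ← Complex.exp_neg, ← Complex.exp_neg, neg_neg] at hlt
    simpa [add_comm] using hlt

open Metric in
/-- A nonvanishing holomorphic function on a disc has a holomorphic logarithm. -/
theorem exists_differentiableOn_exp_eq {f : ℂ → ℂ} {c : ℂ} {R : ℝ}
    (hf : DifferentiableOn ℂ f (ball c R)) (hf0 : ∀ z ∈ ball c R, f z ≠ 0) :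
    ∃ u : ℂ → ℂ, DifferentiableOn ℂ u (ball c R) ∧ ∀ z ∈ ball c R, exp (u z) = f z := by
  rcases le_or_gt R 0 with hR | hR
  · exact ⟨0, by simp [ball_eq_empty.2 hR], by simp [ball_eq_empty.2 hR]⟩
  obtain ⟨u, hu⟩ := ((hf.deriv isOpen_ball).div hf hf0).isExactOn_ball
  have hc : c ∈ ball c R := mem_ball_self hR
  have hud : ∀ z ∈ ball c R, HasDerivAt (fun z => u z - u c + log (f c)) (deriv f z / f z) z :=
    fun z hz => ((hu z hz).sub_const _).add_const _
  refine ⟨fun z => u z - u c + log (f c),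
    fun z hz => (hud z hz).differentiableAt.differentiableWithinAt, fun z hz => ?_⟩
  have hder : ∀ y ∈ ball c R,
      HasDerivAt (fun z => f z * exp (-(u z - u c + log (f c)))) 0 y := by
    intro y hy
    have h1 := (hf.differentiableAt (isOpen_ball.mem_nhds hy)).hasDerivAt.mul (hud y hy).neg.cexp
    refine h1.congr_deriv ?_
    have := hf0 y hy
    field_simp
    ring
  have h2 := (convex_ball c R).norm_image_sub_le_of_norm_hasDerivWithin_le (C := 0)
    (fun y hy => (hder y hy).hasDerivWithinAt) (by simp) hc hz
  rw [zero_mul, norm_le_zero_iff, sub_eq_zero, sub_self, zero_add, exp_neg (log (f c)),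
    exp_log (hf0 c hc), mul_inv_cancel₀ (hf0 c hc), exp_neg] at h2
  exact ((mul_inv_eq_one₀ (exp_ne_zero _)).1 h2).symm

open Metric in
/-- A holomorphic function on a disc omitting `1` and `-1` has a holomorphic arccosine. -/
theorem exists_differentiableOn_cos_eq {f : ℂ → ℂ} {c : ℂ} {R : ℝ}
    (hf : DifferentiableOn ℂ f (ball c R)) (hf0 : ∀ z ∈ ball c R, f z ^ 2 ≠ 1) :
    ∃ u : ℂ → ℂ, DifferentiableOn ℂ u (ball c R) ∧ ∀ z ∈ ball c R, cos (u z) = f z := by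
  obtain ⟨l, hl, hlf⟩ := exists_differentiableOn_exp_eq ((hf.pow 2).sub_const 1)
    (fun z hz => sub_ne_zero.2 (hf0 z hz))
  set q : ℂ → ℂ := fun z => exp (l z / 2) with hq
  have hqd : DifferentiableOn ℂ q (ball c R) := (hl.div_const 2).cexp
  have hqf : ∀ z ∈ ball c R, q z ^ 2 = f z ^ 2 - 1 := fun z hz => by
    rw [show f z ^ 2 - 1 = exp (l z) from (hlf z hz).symm, hq, ← exp_nat_mul]
    congr 1
    push_cast
    ring
  have hmul : ∀ z ∈ ball c R, (f z + q z) * (f z - q z) = 1 := fun z hz => by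
    linear_combination -hqf z hz
  obtain ⟨v, hv, hvf⟩ := exists_differentiableOn_exp_eq (hf.add hqd)
    (fun z hz => left_ne_zero_of_mul_eq_one (hmul z hz))
  refine ⟨fun z => v z * -I, hv.mul_const _, fun z hz => ?_⟩
  have h1 : exp (-v z) = f z - q z := by
    rw [exp_neg, hvf z hz]
    exact inv_eq_of_mul_eq_one_right (hmul z hz)
  have h2 : v z * -I * I = v z := by linear_combination (-v z) * I_mul_I
  rw [cos, neg_mul, h2, h1, hvf z hz]
  simp

/-- Every point of the plane is close to a point whose image under `z ↦ cos (π z)` is an odd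
integer. -/
theorem exists_dist_lt_cos_eq (z : ℂ) :
    ∃ (w : ℂ) (n : ℤ), dist w z < 2 ∧ cos (Real.pi * w) = 2 * n - 1 := by
  set k : ℤ := round (z.re / 2) with hk
  have hk' : |2 * (k : ℝ) - z.re| ≤ 1 := by
    have := abs_sub_round (z.re / 2)
    rw [abs_le] at this ⊢
    constructor <;> linarith [this.1, this.2]
  set n : ℤ := ⌊(Real.cosh (Real.pi * z.im) + 1) / 2⌋ with hn
  have hn1 : (1 : ℝ) ≤ n := by
    have h1 : (1 : ℤ) ≤ n := by
      rw [hn, Int.le_floor]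
      push_cast
      linarith [Real.one_le_cosh (Real.pi * z.im)]
    exact_mod_cast h1
  have hn2 : 2 * (n : ℝ) - 1 ≤ Real.cosh (Real.pi * z.im) := by
    linarith [Int.floor_le ((Real.cosh (Real.pi * z.im) + 1) / 2)]
  have hn3 : Real.cosh (Real.pi * z.im) ≤ 2 * n + 1 := by
    linarith [Int.lt_floor_add_one ((Real.cosh (Real.pi * z.im) + 1) / 2)]
  obtain ⟨y, hy0, hy⟩ : ∃ y : ℝ, 0 ≤ y ∧ Real.cosh (Real.pi * y) = 2 * n - 1 := by
    refine ⟨Real.arcosh (2 * n - 1) / Real.pi,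
      div_nonneg (Real.arcosh_nonneg (by linarith)) Real.pi_pos.le, ?_⟩
    rw [mul_div_cancel₀ _ Real.pi_ne_zero, Real.cosh_arcosh (by linarith)]
  have hy1 : y ≤ |z.im| := by
    rw [← hy, Real.cosh_le_cosh, abs_mul, abs_mul, abs_of_nonneg hy0] at hn2
    exact le_of_mul_le_mul_left hn2 (by positivity)
  have hy2 : |z.im| ≤ y + 1 := by
    have h1 : 3 ≤ Real.cosh Real.pi := by
      have h2 := Real.cosh_eq Real.pi
      have h3 := Real.quadratic_le_exp_of_nonneg Real.pi_pos.le
      have h4 := Real.exp_pos (-Real.pi)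
      have h5 := Real.pi_gt_three
      nlinarith
    have h2 : Real.cosh (Real.pi * z.im) ≤ Real.cosh (Real.pi * (y + 1)) := by
      have h3 : 0 ≤ Real.sinh (Real.pi * y) * Real.sinh Real.pi := mul_nonneg
        (Real.sinh_nonneg_iff.2 (mul_nonneg Real.pi_pos.le hy0))
        (Real.sinh_nonneg_iff.2 Real.pi_pos.le)
      rw [mul_add, mul_one, Real.cosh_add, hy]
      nlinarith
    rw [Real.cosh_le_cosh, abs_mul, abs_mul, abs_of_nonneg (by linarith : 0 ≤ y + 1)] at h2
    exact le_of_mul_le_mul_left h2 (by positivity)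
  obtain ⟨t, ht, htc, hta⟩ : ∃ t : ℝ, |t| = y ∧
      Real.cosh (Real.pi * t) = 2 * n - 1 ∧ |t - z.im| ≤ 1 := by
    rcases le_total 0 z.im with h0 | h0
    · rw [abs_of_nonneg h0] at hy1 hy2
      exact ⟨y, abs_of_nonneg hy0, hy, abs_le.2 ⟨by linarith, by linarith⟩⟩
    · rw [abs_of_nonpos h0] at hy1 hy2
      exact ⟨-y, by rw [abs_neg, abs_of_nonneg hy0], by rw [mul_neg, Real.cosh_neg, hy],
        abs_le.2 ⟨by linarith, by linarith⟩⟩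
  refine ⟨⟨2 * k, t⟩, n, ?_, ?_⟩
  · rw [dist_eq_norm]
    have h1 := Complex.sq_norm ((⟨2 * k, t⟩ : ℂ) - z)
    rw [normSq_apply] at h1
    simp only [sub_re, sub_im] at h1
    have h2 := sq_abs (2 * (k : ℝ) - z.re)
    have h3 := sq_abs (t - z.im)
    nlinarith [abs_nonneg (2 * (k : ℝ) - z.re), abs_nonneg (t - z.im)]
  · have h1 : (Real.pi : ℂ) * (⟨2 * k, t⟩ : ℂ) = ((Real.pi * t : ℝ) : ℂ) * I + k * (2 * Real.pi) := by
      rw [mk_eq_add_mul_I]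
      push_cast
      ring
    rw [h1, cos_add_int_mul_two_pi, cos_mul_I, ← ofReal_cosh, htc]
    push_cast
    ring

open Metric in
/-- Landau's form of the Picard theorem: a holomorphic function on a large disc omitting an
arithmetic progression has small relative oscillation near the centre. -/
theorem exists_forall_norm_sub_le_of_ne_int {δ : ℝ} (hδ : 0 < δ) :
    ∃ R : ℝ, 0 < R ∧ ∀ (W : ℂ → ℂ) (c : ℂ), DifferentiableOn ℂ W (ball c R) →
      (∀ z ∈ ball c R, ∀ n : ℤ, W z ≠ 2 * n - 1) →
      ∀ z ∈ closedBall c Real.pi, ‖W z - W c‖ ≤ δ * (1 + ‖W c‖) := by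
  obtain ⟨η, hη, hcs⟩ : ∃ η : ℝ, 0 < η ∧ ∀ b : ℂ, ‖b‖ ≤ η → ‖cos b - 1‖ + ‖sin b‖ ≤ δ := by
    have h1 : ContinuousAt (fun b : ℂ => ‖cos b - 1‖ + ‖sin b‖) 0 := by fun_prop
    have h2 : ∀ᶠ b in 𝓝 (0 : ℂ), ‖cos b - 1‖ + ‖sin b‖ < δ :=
      h1.eventually_lt_const (by simpa using hδ)
    obtain ⟨η, hη, hsub⟩ := nhds_basis_closedBall.eventually_iff.1 h2
    exact ⟨η, hη, fun b hb => (hsub (mem_closedBall_zero_iff.2 hb)).le⟩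
  set r := 200 * Real.pi ^ 2 / η with hr
  have hrpos : 0 < r := by positivity
  refine ⟨r + Real.pi + 1, by positivity, fun W c hW hn z hz => ?_⟩
  set R := r + Real.pi + 1 with hR
  obtain ⟨v, hv, hvW⟩ := exists_differentiableOn_cos_eq hW (fun y hy heq => by
    rw [sq, mul_self_eq_one_iff] at heq
    rcases heq with h | h
    · exact hn y hy 1 (by rw [h]; norm_num)
    · exact hn y hy 0 (by rw [h]; norm_num))
  have hderiv : ∀ y ∈ closedBall c Real.pi, ‖deriv v y‖ ≤ η / Real.pi := by
    intro y hy
    by_contra! hlt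
    have hsub : ball y (r + 1) ⊆ ball c R :=
      ball_subset_ball' (by rw [hR]; linarith [mem_closedBall.1 hy])
    have hdne : deriv v y ≠ 0 := norm_pos_iff.1 (lt_trans (by positivity) hlt)
    obtain ⟨a, s, -, hs, -, himg⟩ := exists_closedBall_deriv_le_and_subset_image
      (hv.mono hsub) hrpos (lt_add_one r) hdne
    obtain ⟨w, n, hw, hcw⟩ := exists_dist_lt_cos_eq (v a / Real.pi)
    have hmem : Real.pi * w ∈ closedBall (v a) (r * ‖deriv v y‖ / 100) := by
      have h1 : dist (Real.pi * w) (v a) = Real.pi * dist w (v a / Real.pi) := by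
        have h2 : Real.pi * w - v a = Real.pi * (w - v a / Real.pi) := by
          rw [mul_sub, mul_div_cancel₀ _ (ofReal_ne_zero.2 Real.pi_ne_zero)]
        rw [dist_eq_norm, dist_eq_norm, h2, norm_mul, norm_real, Real.norm_eq_abs,
          abs_of_pos Real.pi_pos]
      rw [mem_closedBall, h1]
      have h3 : r * (η / Real.pi) = 200 * Real.pi := by
        rw [hr]
        field_simp
      have h4 : r * (η / Real.pi) ≤ r * ‖deriv v y‖ := by gcongr
      have h5 : Real.pi * dist w (v a / Real.pi) ≤ Real.pi * 2 := by gcongr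
      linarith
    obtain ⟨p, hp, hpw⟩ := himg hmem
    have hpc : p ∈ ball c R :=
      hsub (closedBall_subset_ball (lt_add_one r) (hs hp))
    exact hn p hpc n (by rw [← hvW p hpc, hpw, hcw])
  have hsubc : closedBall c Real.pi ⊆ ball c R :=
    closedBall_subset_ball (by rw [hR]; linarith)
  have hc : c ∈ closedBall c Real.pi := mem_closedBall_self Real.pi_pos.le
  have hb : ‖v z - v c‖ ≤ η := by
    have h1 := (convex_closedBall c Real.pi).norm_image_sub_le_of_norm_deriv_le
      (fun y hy => hv.differentiableAt (isOpen_ball.mem_nhds (hsubc hy))) hderiv hc hz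
    refine h1.trans ?_
    have h2 : ‖z - c‖ ≤ Real.pi := by rw [← dist_eq_norm]; exact hz
    calc η / Real.pi * ‖z - c‖ ≤ η / Real.pi * Real.pi := by gcongr
      _ = η := by field_simp
  have hsin : ‖sin (v c)‖ ≤ 1 + ‖cos (v c)‖ := by
    have h1 : sin (v c) ^ 2 = 1 - cos (v c) ^ 2 := by rw [← sin_sq_add_cos_sq (v c)]; ring
    have h2 : ‖sin (v c)‖ ^ 2 ≤ (1 + ‖cos (v c)‖) ^ 2 := by
      rw [← norm_pow, h1]
      refine (norm_sub_le _ _).trans ?_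
      rw [norm_one, norm_pow]
      nlinarith [norm_nonneg (cos (v c))]
    exact le_of_sq_le_sq h2 (by positivity)
  rw [← hvW z (hsubc hz), ← hvW c (hsubc hc)]
  set b := v z - v c with hbdef
  have hvz : v z = v c + b := by rw [hbdef]; ring
  have hid : cos (v z) - cos (v c) = cos (v c) * (cos b - 1) - sin (v c) * sin b := by
    rw [hvz, cos_add]
    ring
  rw [hid]
  refine (norm_sub_le _ _).trans ?_
  rw [norm_mul, norm_mul]
  have h1 := hcs b hb
  have h2 : ‖cos (v c)‖ * ‖cos b - 1‖ ≤ (1 + ‖cos (v c)‖) * ‖cos b - 1‖ := by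
    gcongr
    linarith
  have h3 : ‖sin (v c)‖ * ‖sin b‖ ≤ (1 + ‖cos (v c)‖) * ‖sin b‖ := by gcongr
  calc _ ≤ (1 + ‖cos (v c)‖) * (‖cos b - 1‖ + ‖sin b‖) := by linarith
    _ ≤ (1 + ‖cos (v c)‖) * δ := by gcongr
    _ = _ := mul_comm _ _

/-- The lift under `exp` of the self-map `z ↦ z ^ m * exp (g z + h z⁻¹)` of `ℂ*`. -/
def logLift (m : ℤ) (g h : ℂ → ℂ) (w : ℂ) : ℂ :=
  m * w + (g (exp w) + h (exp (-w)))

theorem differentiable_logLift (m : ℤ) {g h : ℂ → ℂ} (hg : Differentiable ℂ g)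
    (hh : Differentiable ℂ h) : Differentiable ℂ (logLift m g h) := by
  unfold logLift
  fun_prop

theorem logLift_sub (m : ℤ) (g h : ℂ → ℂ) (z w : ℂ) :
    (g (exp z) + h (exp (-z))) - (g (exp w) + h (exp (-w))) =
      (logLift m g h z - logLift m g h w) - m * (z - w) := by
  unfold logLift
  ring

theorem exists_dist_le_le_abs_re (p : ℂ) {d : ℝ} (hd : 0 ≤ d) :
    ∃ c : ℂ, dist c p ≤ d ∧ d ≤ |c.re| := by
  rcases le_total 0 p.re with h | h
  · refine ⟨p + d, by simp [abs_of_nonneg hd], ?_⟩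
    rw [add_re, ofReal_re]
    exact le_abs.2 (Or.inl (by linarith))
  · refine ⟨p - d, by simp [abs_of_nonneg hd], ?_⟩
    rw [sub_re, ofReal_re]
    exact le_abs.2 (Or.inr (by linarith))

section Lift

variable {m : ℤ} {g h : ℂ → ℂ}

open Metric in
theorem exists_closedBall_subset_image_logLift (hg : Differentiable ℂ g)
    (hh : Differentiable ℂ h) (hgc : ¬ ∃ c : ℂ, ∀ z, g z = c) (hhc : ¬ ∃ c : ℂ, ∀ z, h z = c) :
    ∃ X : ℝ, ∀ c : ℂ, X ≤ |c.re| → ∃ (a : ℂ) (s : ℝ) (c' : ℂ),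
      closedBall a s ⊆ closedBall c 5 ∧
      (∀ z ∈ closedBall a s, 2 ≤ ‖deriv (logLift m g h) z‖) ∧
      closedBall c' 5 ⊆ logLift m g h '' closedBall a s ∧ |c.re| + 1 ≤ |c'.re| := by
  have hF := differentiable_logLift m hg hh
  obtain ⟨X, hX⟩ := exists_re_eq_lt_norm_sub hg hh hgc hhc
    (T := 4 * (Real.pi * (2000 + ‖(m : ℂ)‖))) (by positivity)
  refine ⟨X, fun c hc => ?_⟩
  obtain ⟨w₀, -, hw₀, hlt⟩ := hX c hc
  set x := |c.re| with hx
  have hx0 : 0 ≤ x := abs_nonneg _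
  obtain ⟨w, hwc, hw⟩ : ∃ w ∈ closedBall c Real.pi,
      2000 * (1 + x) ≤ ‖deriv (logLift m g h) w‖ := by
    by_contra! hcon
    have h1 := (convex_closedBall c Real.pi).norm_image_sub_le_of_norm_deriv_le
      (fun y _ => hF y) (fun y hy => (hcon y hy).le) (mem_closedBall_self Real.pi_pos.le)
      (show w₀ ∈ closedBall c Real.pi by rwa [mem_closedBall, dist_eq_norm])
    rw [logLift_sub m] at hlt
    have h2 := norm_sub_le (logLift m g h w₀ - logLift m g h c) (m * (w₀ - c))
    rw [norm_mul] at h2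
    have h3 : 2000 * (1 + x) * ‖w₀ - c‖ ≤ 2000 * (1 + x) * Real.pi := by gcongr
    have h4 : ‖(m : ℂ)‖ * ‖w₀ - c‖ ≤ ‖(m : ℂ)‖ * Real.pi := by gcongr
    have h5 := norm_nonneg (g (exp c) + h (exp (-c)))
    have h6 : 0 ≤ Real.pi * ‖(m : ℂ)‖ * x := by positivity
    linarith
  have hdne : deriv (logLift m g h) w ≠ 0 := norm_pos_iff.1 (lt_of_lt_of_le (by positivity) hw)
  obtain ⟨a, s, -, hsub, hder, himg⟩ := exists_closedBall_deriv_le_and_subset_image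
    (hF.differentiableOn (s := ball w 2)) one_pos one_lt_two hdne
  obtain ⟨c', hc', hc're⟩ := exists_dist_le_le_abs_re (logLift m g h a)
    (d := 10 * (1 + x)) (by positivity)
  refine ⟨a, s, c', hsub.trans (closedBall_subset_closedBall' ?_), fun z hz => ?_,
    (closedBall_subset_closedBall' ?_).trans himg, by linarith⟩
  · linarith [mem_closedBall.1 hwc, Real.pi_lt_four]
  · linarith [hder z hz]
  · linarith

open Metric in
theorem exists_mem_ball_exp_logLift_eq (hg : Differentiable ℂ g)
    (hh : Differentiable ℂ h) (hgc : ¬ ∃ c : ℂ, ∀ z, g z = c) (hhc : ¬ ∃ c : ℂ, ∀ z, h z = c) :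
    ∃ R : ℝ, 0 < R ∧ ∀ τ : ℂ, ∃ X : ℝ, ∀ c : ℂ, X ≤ |c.re| →
      ∃ p ∈ ball c R, exp (logLift m g h p) = exp τ := by
  have hF := differentiable_logLift m hg hh
  obtain ⟨R, hR, hosc⟩ := exists_forall_norm_sub_le_of_ne_int (δ := 1 / 4) (by norm_num)
  refine ⟨R, hR, fun τ => ?_⟩
  obtain ⟨X, hX⟩ := exists_re_eq_lt_norm_sub hg hh hgc hhc
    (T := 2 * Real.pi + ‖τ‖ + ‖(m : ℂ)‖ * (5 * Real.pi + 1)) (by positivity)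
  refine ⟨X, fun c hc => ?_⟩
  obtain ⟨w, -, hw, hlt⟩ := hX c hc
  by_contra! hcon
  set k : ℤ := round (c.im / (2 * Real.pi)) with hk
  have hkc : ‖c - k * (2 * Real.pi * I)‖ ≤ |c.re| + Real.pi := by
    have h1 := abs_sub_round (c.im / (2 * Real.pi))
    have h2 : |c.im - k * (2 * Real.pi)| ≤ Real.pi := by
      have h3 : c.im - k * (2 * Real.pi) = (c.im / (2 * Real.pi) - k) * (2 * Real.pi) := by
        field_simp
      rw [h3, abs_mul, abs_of_pos Real.two_pi_pos]
      have h4 := mul_le_mul_of_nonneg_right h1 Real.two_pi_pos.le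
      linarith
    refine (Complex.norm_le_abs_re_add_abs_im _).trans ?_
    simpa using h2
  have hpi : (Real.pi : ℂ) * I ≠ 0 := mul_ne_zero (ofReal_ne_zero.2 Real.pi_ne_zero) I_ne_zero
  set σ : ℂ := τ + m * (k * (2 * Real.pi * I)) with hσ
  set W : ℂ → ℂ := fun z => (logLift m g h z - σ) / (Real.pi * I) - 1 with hW
  have h1 := hosc W c (((hF.sub_const σ).div_const _).sub_const 1).differentiableOn
    (fun z hz n heq => hcon z hz (by
      have h2 : logLift m g h z - σ = 2 * n * (Real.pi * I) := by
        rw [← div_eq_iff hpi]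
        linear_combination heq
      rw [exp_eq_exp_iff_exists_int]
      refine ⟨n + m * k, ?_⟩
      push_cast
      linear_combination h2 + hσ)) w (by rwa [mem_closedBall, dist_eq_norm])
  have hnpi : ‖(Real.pi : ℂ) * I‖ = Real.pi := by simp [abs_of_pos Real.pi_pos]
  have h3 : logLift m g h w - logLift m g h c = (Real.pi * I) * (W w - W c) := by
    rw [hW]
    field_simp
    ring
  have h4 : (Real.pi * I) * W c =
      m * (c - k * (2 * Real.pi * I)) + (g (exp c) + h (exp (-c))) - τ - Real.pi * I := by
    simp only [hW, hσ, logLift]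
    field_simp
    ring
  have h5 : Real.pi * ‖W c‖ ≤ ‖(m : ℂ)‖ * (|c.re| + Real.pi) +
      ‖g (exp c) + h (exp (-c))‖ + ‖τ‖ + Real.pi := by
    calc Real.pi * ‖W c‖ = ‖(Real.pi * I) * W c‖ := by rw [norm_mul, hnpi]
      _ ≤ ‖(m : ℂ) * (c - k * (2 * Real.pi * I))‖ + ‖g (exp c) + h (exp (-c))‖ + ‖τ‖ +
          ‖(Real.pi : ℂ) * I‖ := by
        rw [h4]
        exact (norm_sub_le _ _).trans (add_le_add_left ((norm_sub_le _ _).trans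
          (add_le_add_left (norm_add_le _ _) _)) _)
      _ ≤ _ := by
        rw [norm_mul, hnpi]
        gcongr
  rw [logLift_sub m, h3] at hlt
  have h6 := norm_sub_le ((Real.pi * I) * (W w - W c)) (m * (w - c))
  rw [norm_mul (Real.pi * I : ℂ), norm_mul (m : ℂ), hnpi] at h6
  have h7 : ‖(m : ℂ)‖ * ‖w - c‖ ≤ ‖(m : ℂ)‖ * Real.pi := by gcongr
  have h8 := mul_le_mul_of_nonneg_left h1 Real.pi_pos.le
  have h9 : 0 ≤ (2 * Real.pi + ‖τ‖ + ‖(m : ℂ)‖ * (5 * Real.pi)) * |c.re| := by positivity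
  linarith [norm_nonneg (m : ℂ)]

/-- A point following a sequence of compact sets, each of which covers the next one. -/
theorem exists_forall_iterate_mem {α : Type*} [TopologicalSpace α] [T2Space α] {F : α → α}
    (hF : Continuous F) {B : ℕ → Set α} (hB : ∀ n, IsCompact (B n)) (h0 : ∀ n, (B n).Nonempty)
    (hsub : ∀ n, B (n + 1) ⊆ F '' B n) : ∃ x, ∀ n, F^[n] x ∈ B n := by
  have hcl : ∀ n, IsClosed {x | ∀ i ≤ n, F^[i] x ∈ B i} := fun n => by
    simp only [ofPred_forall]
    exact isClosed_iInter fun i => isClosed_iInter fun _ =>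
      (hB i).isClosed.preimage (hF.iterate i)
  have hcov : ∀ n, ∀ y ∈ B n, ∃ x, F^[n] x = y ∧ ∀ i ≤ n, F^[i] x ∈ B i := by
    intro n
    induction n with
    | zero => exact fun y hy => ⟨y, rfl, fun i hi => by simpa [Nat.le_zero.1 hi] using hy⟩
    | succ n ih =>
      intro y hy
      obtain ⟨z, hz, rfl⟩ := hsub n hy
      obtain ⟨x, hx, hxi⟩ := ih z hz
      have hx' : F^[n + 1] x = F z := by rw [iterate_succ_apply', hx]
      refine ⟨x, hx', fun i hi => ?_⟩
      rcases Nat.le_succ_iff.1 hi with h | rfl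
      · exact hxi i h
      · rwa [hx']
  obtain ⟨x, hx⟩ := IsCompact.nonempty_iInter_of_sequence_nonempty_isCompact_isClosed
    (fun n => {x | ∀ i ≤ n, F^[i] x ∈ B i}) (fun n x hx i hi => hx i (hi.trans n.le_succ))
    (fun n => by
      obtain ⟨y, hy⟩ := h0 n
      obtain ⟨x, -, hx⟩ := hcov n y hy
      exact ⟨x, hx⟩)
    ((hB 0).of_isClosed_subset (hcl 0) fun x hx => hx 0 le_rfl) hcl
  exact ⟨x, fun n => mem_iInter.1 hx n n le_rfl⟩

open Metric in
theorem exists_escaping_expanding_logLift (hg : Differentiable ℂ g)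
    (hh : Differentiable ℂ h) (hgc : ¬ ∃ c : ℂ, ∀ z, g z = c) (hhc : ¬ ∃ c : ℂ, ∀ z, h z = c) :
    ∃ w : ℂ, ∀ n : ℕ, 2 ^ n ≤ ‖deriv (logLift m g h)^[n] w‖ ∧
      (n : ℝ) - 5 ≤ |((logLift m g h)^[n] w).re| := by
  have hF := differentiable_logLift m hg hh
  obtain ⟨X, hX⟩ := exists_closedBall_subset_image_logLift (m := m) hg hh hgc hhc
  choose a s c' hsub hder himg hre using hX
  set C : ℕ → {c : ℂ // X ≤ |c.re|} := fun n => Nat.rec ⟨(X : ℂ), le_abs_self X⟩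
    (fun _ c => ⟨c' c.1 c.2, by linarith [hre c.1 c.2, c.2]⟩) n with hC
  have hCsucc : ∀ n, (C (n + 1)).1 = c' (C n).1 (C n).2 := fun n => rfl
  have hCre : ∀ n : ℕ, (n : ℝ) ≤ |(C n).1.re| := by
    intro n
    induction n with
    | zero => simp
    | succ n ih =>
      rw [hCsucc]
      push_cast
      linarith [hre (C n).1 (C n).2]
  set B : ℕ → Set ℂ := fun n => closedBall (a (C n).1 (C n).2) (s (C n).1 (C n).2) with hBdef
  have hcover : ∀ n, closedBall (C (n + 1)).1 5 ⊆ logLift m g h '' B n := fun n => by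
    rw [hCsucc]
    exact himg _ _
  obtain ⟨w, hw⟩ := exists_forall_iterate_mem hF.continuous (B := B)
    (fun n => isCompact_closedBall _ _)
    (fun n => Set.image_nonempty.1
      ((nonempty_closedBall.2 (by norm_num)).mono (hcover n)))
    (fun n => (hsub _ _).trans (hcover n))
  refine ⟨w, fun n => ⟨?_, ?_⟩⟩
  · induction n with
    | zero => simp
    | succ n ih =>
      rw [iterate_succ', deriv_comp w (hF _) ((hF.iterate n) w), norm_mul, pow_succ']
      exact mul_le_mul (hder _ _ _ (hw n)) ih (by positivity) (norm_nonneg _)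
  · have h1 := mem_closedBall.1 (hsub _ _ (hw n))
    rw [dist_eq_norm] at h1
    have h2 := (Complex.abs_re_le_norm _).trans h1
    rw [sub_re] at h2
    have h3 := abs_sub_abs_le_abs_sub (C n).1.re ((logLift m g h)^[n] w).re
    rw [abs_sub_comm] at h3
    linarith [hCre n]

open Metric in
/-- The blowing-up property at a point along whose orbit the lift expands. -/
theorem eventually_exists_mem_ball_exp_iterate_logLift_eq (hg : Differentiable ℂ g)
    (hh : Differentiable ℂ h) (hgc : ¬ ∃ c : ℂ, ∀ z, g z = c) (hhc : ¬ ∃ c : ℂ, ∀ z, h z = c)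
    {w : ℂ} (hw : ∀ n : ℕ, 2 ^ n ≤ ‖deriv (logLift m g h)^[n] w‖) {ε : ℝ} (hε : 0 < ε) (τ : ℂ) :
    ∀ᶠ n in atTop, ∃ q ∈ ball w ε, exp ((logLift m g h)^[n] q) = exp τ := by
  have hF := differentiable_logLift m hg hh
  obtain ⟨R, hR, hhit⟩ := exists_mem_ball_exp_logLift_eq (m := m) hg hh hgc hhc
  obtain ⟨X, hX⟩ := hhit τ
  have hlim : Tendsto (fun n : ℕ => ε / 2 * (2 : ℝ) ^ n / 100) atTop atTop :=
    ((tendsto_pow_atTop_atTop_of_one_lt one_lt_two).const_mul_atTop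
      (half_pos hε)).atTop_div_const (by norm_num)
  suffices H : ∀ᶠ n in atTop, ∃ q ∈ ball w ε, exp ((logLift m g h)^[n + 1] q) = exp τ by
    obtain ⟨N, hN⟩ := eventually_atTop.1 H
    refine eventually_atTop.2 ⟨N + 1, fun n hn => ?_⟩
    have := hN (n - 1) (by omega)
    rwa [Nat.sub_add_cancel (by omega)] at this
  filter_upwards [hlim.eventually_ge_atTop (|X| + R)] with n hn
  have hdne : deriv (logLift m g h)^[n] w ≠ 0 :=
    norm_pos_iff.1 (lt_of_lt_of_le (by positivity) (hw n))
  obtain ⟨a, s, -, hsub, -, himg⟩ := exists_closedBall_deriv_le_and_subset_image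
    ((hF.iterate n).differentiableOn (s := ball w ε)) (half_pos hε) (half_lt_self hε) hdne
  obtain ⟨c, hc, hcre⟩ := exists_dist_le_le_abs_re ((logLift m g h)^[n] a) (abs_nonneg X)
  obtain ⟨p, hp, hpτ⟩ := hX c ((le_abs_self X).trans hcre)
  have h1 : ε / 2 * 2 ^ n ≤ ε / 2 * ‖deriv (logLift m g h)^[n] w‖ := by
    have := hw n
    gcongr
  obtain ⟨q, hq, rfl⟩ := himg (closedBall_subset_closedBall'
    (by linarith) (ball_subset_closedBall hp))
  refine ⟨q, closedBall_subset_ball (half_lt_self hε) (hsub hq), ?_⟩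
  rwa [iterate_succ_apply']

end Lift

theorem isOpen_connectedComponent_of_finite {X : Type*} [TopologicalSpace X]
    [Finite (ConnectedComponents X)] (x : X) : IsOpen (connectedComponent x) :=
  ConnectedComponents.discreteTopology_iff.1 inferInstance x

theorem mem_escapingSet_of_iterate_mem {f : ℂ → ℂ} {z : ℂ} (hz : z ≠ 0) {k : ℕ}
    (h : f^[k] z ∈ escapingSet f) : z ∈ escapingSet f := by
  refine ⟨hz, fun ε hε => ?_⟩
  obtain ⟨N, hN⟩ := h.2 ε hε
  refine ⟨N + k, fun n hn => ?_⟩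
  have h1 := hN (n - k) (by omega)
  rwa [← iterate_add_apply, Nat.sub_add_cancel (by omega)] at h1

theorem iterate_mem_escapingSet {f : ℂ → ℂ} (hf : ∀ z, z ≠ 0 → f z ≠ 0) {z : ℂ}
    (hz : z ∈ escapingSet f) (k : ℕ) : f^[k] z ∈ escapingSet f := by
  refine ⟨?_, fun ε hε => ?_⟩
  · exact (show MapsTo f {z | z ≠ 0} {z | z ≠ 0} from hf).iterate k hz.1
  · obtain ⟨N, hN⟩ := hz.2 ε hε
    refine ⟨N, fun n hn => ?_⟩
    rw [← iterate_add_apply]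
    exact hN (n + k) (by omega)

/-- A point whose neighbourhoods blow up over the escaping set forces the escaping set to be
connected, provided it has finitely many components. -/
theorem isPreconnected_escapingSet_of_blowup {f : ℂ → ℂ} (hf0 : ∀ z, z ≠ 0 → f z ≠ 0)
    (hfc : ContinuousOn f {z | z ≠ 0}) {z : ℂ} (hz : z ∈ escapingSet f)
    (hblow : ∀ U ∈ 𝓝 z, ∀ x, x ≠ 0 → ∀ᶠ n in atTop, ∃ u ∈ U, u ≠ 0 ∧ f^[n] u = x)
    [Finite (ConnectedComponents (escapingSet f))] : IsPreconnected (escapingSet f) := by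
  obtain ⟨U, hUo, hU⟩ := isOpen_induced_iff.1
    (isOpen_connectedComponent_of_finite (⟨z, hz⟩ : escapingSet f))
  have hzU : U ∈ 𝓝 z := hUo.mem_nhds (by
    have : (⟨z, hz⟩ : escapingSet f) ∈ Subtype.val ⁻¹' U := hU ▸ mem_connectedComponent
    exact this)
  have hmem : ∀ u ∈ U, u ∈ escapingSet f → u ∈ connectedComponentIn (escapingSet f) z := by
    intro u hu huI
    rw [connectedComponentIn_eq_image hz, ← hU]
    exact ⟨⟨u, huI⟩, hu, rfl⟩
  have hmaps : MapsTo f {z | z ≠ 0} {z | z ≠ 0} := hf0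
  have hiter : ∀ n, ContinuousOn f^[n] {z | z ≠ 0} := fun n => by
    induction n with
    | zero => exact continuousOn_id
    | succ n ih =>
      rw [iterate_succ']
      exact hfc.comp ih (hmaps.iterate n)
  refine isPreconnected_of_forall_pair fun x hx y hy => ?_
  obtain ⟨n, ⟨u, hu, hu0, rfl⟩, v, hv, hv0, rfl⟩ :=
    ((hblow U hzU x hx.1).and (hblow U hzU y hy.1)).exists
  refine ⟨f^[n] '' connectedComponentIn (escapingSet f) z, ?_,
    mem_image_of_mem _ (hmem u hu (mem_escapingSet_of_iterate_mem hu0 hx)),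
    mem_image_of_mem _ (hmem v hv (mem_escapingSet_of_iterate_mem hv0 hy)),
    isPreconnected_connectedComponentIn.image _
      ((hiter n).mono fun p hp => (connectedComponentIn_subset _ _ hp).1)⟩
  rintro _ ⟨p, hp, rfl⟩
  exact iterate_mem_escapingSet hf0 (connectedComponentIn_subset _ _ hp) n

/-- For a transcendental self-map `f` of `ℂ*`, the escaping set `I(f)` is
either connected or has infinitely many connected components. -/
theorem escapingSet_connected_or_infinite_components (f : ℂ → ℂ)
    (hf : IsTranscendentalSelfMapCStar f) :
    IsConnected (escapingSet f) ∨ Infinite (ConnectedComponents ↥(escapingSet f)) := by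
  obtain ⟨m, g, h, hg, hh, hgc, hhc, hfe⟩ := hf
  have hf0 : ∀ z, z ≠ 0 → f z ≠ 0 := fun z hz => by
    rw [hfe z hz]
    exact mul_ne_zero (zpow_ne_zero m hz) (exp_ne_zero _)
  have hfc : ContinuousOn f {z | z ≠ 0} := by
    refine ContinuousOn.congr (f := fun z => z ^ m * exp (g z + h z⁻¹)) ?_ hfe
    intro z hz
    have h1 : ContinuousAt (fun z : ℂ => z ^ m) z := continuousAt_zpow₀ z m (Or.inl hz)
    have h2 : ContinuousAt (fun z : ℂ => h z⁻¹) z :=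
      hh.continuous.continuousAt.comp (continuousAt_inv₀ hz)
    exact (h1.mul (hg.continuous.continuousAt.add h2).cexp).continuousWithinAt
  have hsemi : Semiconj exp (logLift m g h) f := fun w => by
    rw [hfe _ (exp_ne_zero w), logLift, exp_add, exp_int_mul, exp_neg w]
  have hiter : ∀ n w, f^[n] (exp w) = exp ((logLift m g h)^[n] w) := fun n w =>
    ((hsemi.iterate_right n) w).symm
  obtain ⟨w, hw⟩ := exists_escaping_expanding_logLift (m := m) hg hh hgc hhc
  have hwI : exp w ∈ escapingSet f := by
    refine ⟨exp_ne_zero w, fun ε hε => ?_⟩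
    obtain ⟨N, hN⟩ := exists_nat_gt (|Real.log ε| + 5)
    refine ⟨N, fun n hn => ?_⟩
    have h1 : (N : ℝ) ≤ n := by exact_mod_cast hn
    have h2 : |Real.log ε| < |((logLift m g h)^[n] w).re| := by linarith [(hw n).2]
    rw [hiter, Complex.norm_exp, ← Real.lt_log_iff_exp_lt hε, one_div,
      ← Real.log_lt_iff_lt_exp (inv_pos.2 hε), Real.log_inv]
    rcases lt_abs.1 h2 with h3 | h3
    · exact Or.inr ((neg_le_abs _).trans_lt h3)
    · exact Or.inl (by linarith [neg_abs_le (Real.log ε)])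
  rcases finite_or_infinite (ConnectedComponents (escapingSet f)) with hfin | hinf
  · refine Or.inl ⟨⟨_, hwI⟩, isPreconnected_escapingSet_of_blowup hf0 hfc hwI ?_⟩
    intro U hU x hx
    obtain ⟨ε, hε, hεU⟩ := Metric.mem_nhds_iff.1 (continuous_exp.continuousAt hU)
    filter_upwards [eventually_exists_mem_ball_exp_iterate_logLift_eq hg hh hgc hhc
      (fun n => (hw n).1) hε (log x)] with n hn
    obtain ⟨q, hq, hqx⟩ := hn
    exact ⟨exp q, hεU hq, exp_ne_zero q, by rw [hiter, hqx, exp_log hx]⟩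
  · exact Or.inr hinf
end
end

section
/- Let f be a transcendental self-map of ℂ* and let e ∈ {0,∞}^ℕ be a sequence of symbols. Then the little escaping set I_e(f) is either connected or it has infinitely many connected components. -/
open Complex Topology Filter Set Function OnePoint

noncomputable section

/-! ### Bloch's theorem and Schottky's theorem -/

/-- A holomorphic function on a disc whose derivative is at most twice its value at the centre
covers a disc of comparable size. -/
lemma ball_subset_image_of_norm_deriv_le {G : ℂ → ℂ} {z : ℂ} {t : ℝ}
    (hG : DifferentiableOn ℂ G (Metric.ball z t)) (h0 : deriv G z ≠ 0)
    (hle : ∀ w ∈ Metric.ball z t, ‖deriv G w‖ ≤ 2 * ‖deriv G z‖) (ht : 0 < t) :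
    Metric.ball (G z) (t * ‖deriv G z‖ / 24) ⊆ G '' Metric.ball z t := by
  set M := ‖deriv G z‖ with hM
  have hMpos : 0 < M := norm_pos_iff.2 h0
  have hd : DifferentiableOn ℂ (deriv G) (Metric.ball z t) := hG.deriv Metric.isOpen_ball
  have hsub : Metric.closedBall z (t / 6) ⊆ Metric.ball z t :=
    Metric.closedBall_subset_ball (by linarith)
  have hder : ∀ w ∈ Metric.closedBall z (t / 6), ‖deriv G w - deriv G z‖ ≤ M / 2 := by
    intro w hw
    have hmaps : MapsTo (deriv G) (Metric.ball z t) (Metric.closedBall (deriv G z) (3 * M)) := by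
      intro u hu
      rw [mem_closedBall_iff_norm]
      linarith [norm_sub_le (deriv G u) (deriv G z), hle u hu]
    have := dist_le_div_mul_dist_of_mapsTo_ball hd hmaps (hsub hw)
    rw [dist_eq_norm] at this
    calc _ ≤ 3 * M / t * dist w z := this
      _ ≤ 3 * M / t * (t / 6) := by gcongr; exact hw
      _ = M / 2 := by field_simp; norm_num
  have hlow : ∀ w ∈ Metric.sphere z (t / 6), t * M / 12 ≤ ‖G w - G z‖ := by
    intro w hw
    have hwz : ‖w - z‖ = t / 6 := mem_sphere_iff_norm.1 hw
    have key := (convex_closedBall z (t / 6)).norm_image_sub_le_of_norm_hasDerivWithin_le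
      (f := fun u => G u - deriv G z * u) (f' := fun u => deriv G u - deriv G z) (C := M / 2)
      (fun u hu => by
        have h1 : HasDerivAt G (deriv G u) u :=
          (hG.differentiableAt (Metric.isOpen_ball.mem_nhds (hsub hu))).hasDerivAt
        have h2 : HasDerivAt (fun u => deriv G z * u) (deriv G z) u := by
          simpa using (hasDerivAt_id u).const_mul (deriv G z)
        exact (h1.sub h2).hasDerivWithinAt)
      hder (Metric.mem_closedBall_self (by positivity)) (Metric.sphere_subset_closedBall hw)
    have h3 : ‖deriv G z * (w - z)‖ = M * (t / 6) := by rw [norm_mul, hwz]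
    have h4 : ‖deriv G z * (w - z)‖ ≤
        ‖G w - G z‖ + ‖(G w - deriv G z * w) - (G z - deriv G z * z)‖ := by
      refine le_trans (le_of_eq ?_) (norm_sub_le _ _)
      congr 1; ring
    rw [hwz] at key
    linarith
  have hfreq : ∃ᶠ w in 𝓝 z, G w ≠ G z := by
    have h1 : HasDerivAt G (deriv G z) z :=
      (hG.differentiableAt (Metric.ball_mem_nhds z ht)).hasDerivAt
    have h2 : ∃ᶠ w in 𝓝[≠] z, G w ≠ G z := (h1.eventually_ne h0).frequently
    exact h2.filter_mono nhdsWithin_le_nhds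
  have hdc : DiffContOnCl ℂ G (Metric.ball z (t / 6)) :=
    DifferentiableOn.diffContOnCl (hG.mono (Metric.closure_ball_subset_closedBall.trans hsub))
  have := hdc.ball_subset_image_closedBall (by positivity) hlow hfreq
  rw [show t * M / 24 = t * M / 12 / 2 by ring]
  exact this.trans (image_mono hsub)

/-- **Bloch's theorem**, with a non-optimal constant. -/
lemma exists_ball_subset_image {G : ℂ → ℂ} {c : ℂ} {R : ℝ} (hR : 0 < R)
    (hG : DifferentiableOn ℂ G (Metric.ball c R)) :
    ∃ v, Metric.ball v (R * ‖deriv G c‖ / 96) ⊆ G '' Metric.ball c R := by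
  by_cases h0 : deriv G c = 0
  · exact ⟨0, by simp [h0]⟩
  have hsub : Metric.closedBall c (R / 2) ⊆ Metric.ball c R :=
    Metric.closedBall_subset_ball (by linarith)
  have hcont : ContinuousOn (fun z => (R / 2 - dist z c) * ‖deriv G z‖)
      (Metric.closedBall c (R / 2)) := by
    have := ((hG.deriv Metric.isOpen_ball).continuousOn.mono hsub).norm
    fun_prop
  obtain ⟨z, hz, hmax⟩ := (isCompact_closedBall c (R / 2)).exists_isMaxOn
    ⟨c, Metric.mem_closedBall_self (by positivity)⟩ hcont
  rw [isMaxOn_iff] at hmax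
  have hc := hmax c (Metric.mem_closedBall_self (by positivity))
  simp only [dist_self, sub_zero] at hc
  have hMc : 0 < ‖deriv G c‖ := norm_pos_iff.2 h0
  have hpos : 0 < (R / 2 - dist z c) * ‖deriv G z‖ := lt_of_lt_of_le (by positivity) hc
  have ht : 0 < R / 2 - dist z c := pos_of_mul_pos_left hpos (norm_nonneg _)
  have hz0 : 0 < ‖deriv G z‖ := pos_of_mul_pos_right hpos ht.le
  set t := (R / 2 - dist z c) / 2 with htdef
  have hball : Metric.ball z t ⊆ Metric.closedBall c (R / 2) := fun w hw => by
    have h1 := dist_triangle w z c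
    have h2 : dist w z < t := hw
    rw [Metric.mem_closedBall]
    linarith
  have hle : ∀ w ∈ Metric.ball z t, ‖deriv G w‖ ≤ 2 * ‖deriv G z‖ := by
    intro w hw
    have h1 := hmax w (hball hw)
    have h2 : t ≤ R / 2 - dist w c := by
      have h1 := dist_triangle w z c
      have h2 : dist w z < t := hw
      linarith
    have h3 : t * ‖deriv G w‖ ≤ t * (2 * ‖deriv G z‖) := by
      calc _ ≤ (R / 2 - dist w c) * ‖deriv G w‖ := by gcongr
        _ ≤ _ := h1
        _ = _ := by rw [htdef]; ring
    exact le_of_mul_le_mul_left h3 (by positivity)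
  refine ⟨G z, (Metric.ball_subset_ball ?_).trans
    ((ball_subset_image_of_norm_deriv_le (hG.mono (hball.trans hsub)) (norm_pos_iff.1 hz0) hle
      (by positivity)).trans (image_mono (hball.trans hsub)))⟩
  have : t * ‖deriv G z‖ = (R / 2 - dist z c) * ‖deriv G z‖ / 2 := by rw [htdef]; ring
  linarith

/-- A holomorphic function on a disc whose image contains no disc of radius `B` has bounded
oscillation on the concentric disc of half the radius. -/
lemma norm_sub_le_of_forall_ball_not_subset {V : ℂ → ℂ} {c : ℂ} {R B : ℝ} (hB : 0 < B)
    (hV : DifferentiableOn ℂ V (Metric.ball c R))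
    (hno : ∀ v, ¬ Metric.ball v B ⊆ V '' Metric.ball c R)
    {x y : ℂ} (hx : x ∈ Metric.ball c (R / 2)) (hy : y ∈ Metric.ball c (R / 2)) :
    ‖V x - V y‖ ≤ 192 * B := by
  have hR : 0 < R := by
    have := Metric.pos_of_mem_ball hx
    linarith
  have hsub : Metric.ball c (R / 2) ⊆ Metric.ball c R := Metric.ball_subset_ball (by linarith)
  have hder : ∀ u ∈ Metric.ball c (R / 2), ‖deriv V u‖ ≤ 192 * B / R := by
    intro u hu
    have hu' : Metric.ball u (R / 2) ⊆ Metric.ball c R := fun w hw => by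
      rw [Metric.mem_ball] at *
      linarith [dist_triangle w u c]
    obtain ⟨v, hv⟩ := exists_ball_subset_image (half_pos hR) (hV.mono hu')
    by_contra! hlt
    refine hno v ((Metric.ball_subset_ball ?_).trans (hv.trans (image_mono hu')))
    rw [div_lt_iff₀ hR] at hlt
    linarith
  have h := (convex_ball c (R / 2)).norm_image_sub_le_of_norm_deriv_le
    (fun u hu => hV.differentiableAt (Metric.isOpen_ball.mem_nhds (hsub hu))) hder hy hx
  have hxy : ‖x - y‖ ≤ R := by
    rw [← dist_eq_norm]
    rw [Metric.mem_ball] at *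
    linarith [dist_triangle_right x y c]
  calc _ ≤ 192 * B / R * ‖x - y‖ := h
    _ ≤ 192 * B / R * R := by gcongr
    _ = 192 * B := by field_simp

/-- A nonvanishing holomorphic function on a disc has a holomorphic logarithm, which may be
normalised at a given point. -/
lemma exists_exp_eq_of_ne_zero {g : ℂ → ℂ} {c : ℂ} {R : ℝ}
    (hg : DifferentiableOn ℂ g (Metric.ball c R)) (h0 : ∀ z ∈ Metric.ball c R, g z ≠ 0)
    {x : ℂ} (hx : x ∈ Metric.ball c R) :
    ∃ L : ℂ → ℂ, DifferentiableOn ℂ L (Metric.ball c R) ∧ L x = Complex.log (g x) ∧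
      ∀ z ∈ Metric.ball c R, Complex.exp (L z) = g z := by
  have hd : DifferentiableOn ℂ (fun z => deriv g z / g z) (Metric.ball c R) :=
    (hg.deriv Metric.isOpen_ball).div hg h0
  obtain ⟨L, hLx, hL⟩ := hd.isExactOn_ball.with_val_at x (Complex.log (g x))
  refine ⟨L, fun z hz => (hL z hz).differentiableAt.differentiableWithinAt, hLx, fun z hz => ?_⟩
  have hgd : ∀ w ∈ Metric.ball c R, HasDerivAt g (deriv g w) w := fun w hw =>
    (hg.differentiableAt (Metric.isOpen_ball.mem_nhds hw)).hasDerivAt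
  have hq : ∀ w ∈ Metric.ball c R,
      HasDerivWithinAt (fun w => g w * Complex.exp (-L w)) 0 (Metric.ball c R) w := by
    intro w hw
    have h := (hgd w hw).mul ((hL w hw).neg.cexp)
    refine (h.congr_deriv ?_).hasDerivWithinAt
    have := h0 w hw
    field_simp
    ring
  have hcst := (convex_ball c R).norm_image_sub_le_of_norm_hasDerivWithin_le
    (C := 0) hq (by simp) hx hz
  rw [zero_mul, norm_le_zero_iff, sub_eq_zero, hLx, Complex.exp_neg, Complex.exp_neg,
    Complex.exp_log (h0 x hx), mul_inv_cancel₀ (h0 x hx)] at hcst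
  exact ((mul_inv_eq_one₀ (Complex.exp_ne_zero _)).1 hcst).symm

/-- Points at which `cosh` takes integer values are relatively dense in the plane. -/
lemma exists_cosh_eq_intCast_dist_lt (v : ℂ) :
    ∃ w ∈ Metric.ball v 6, ∃ n : ℤ, Complex.cosh w = n := by
  have hreal : ∃ u : ℝ, |u - v.re| ≤ 2 ∧ ∃ n : ℤ, Real.cosh u = n := by
    set x := |v.re| with hx
    have hx1 : 1 ≤ Real.cosh x := Real.one_le_cosh x
    have hn : (1 : ℝ) ≤ (⌊Real.cosh x⌋ : ℤ) := by exact_mod_cast Int.le_floor.2 (by simp)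
    set y := Real.arcosh (⌊Real.cosh x⌋ : ℤ) with hy
    have hcy : Real.cosh y = (⌊Real.cosh x⌋ : ℤ) := Real.cosh_arcosh hn
    have hy0 : 0 ≤ y := Real.arcosh_nonneg hn
    have hyx : y ≤ x := by
      have : Real.cosh y ≤ Real.cosh x := hcy ▸ Int.floor_le _
      rw [Real.cosh_le_cosh, abs_of_nonneg hy0] at this
      simpa [hx] using this
    have hxy : x ≤ y + 2 := by
      by_contra! hlt
      have h1 : Real.cosh (y + 2) < Real.cosh x := by
        rw [Real.cosh_lt_cosh, abs_of_nonneg (by linarith), abs_of_nonneg (by linarith)]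
        exact hlt
      rw [Real.cosh_add] at h1
      have h2 : (2 : ℝ) ≤ Real.cosh 2 := by
        rw [Real.cosh_eq]
        have h3 : (1 + 1) ^ 2 ≤ Real.exp 2 := by
          rw [show (2 : ℝ) = 1 + 1 by norm_num, Real.exp_add, ← sq]
          gcongr
          exact Real.add_one_le_exp 1
        linarith [Real.exp_pos (-2)]
      have h3 : 0 ≤ Real.sinh y * Real.sinh 2 :=
        mul_nonneg (Real.sinh_nonneg_iff.2 hy0) (Real.sinh_nonneg_iff.2 (by norm_num))
      have h4 := Int.lt_floor_add_one (Real.cosh x)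
      nlinarith
    rcases le_total 0 v.re with h | h
    · refine ⟨y, ?_, _, hcy⟩
      rw [abs_of_nonneg h] at hx
      rw [abs_le]; constructor <;> linarith
    · refine ⟨-y, ?_, _, by rw [Real.cosh_neg, hcy]⟩
      rw [abs_of_nonpos h] at hx
      rw [abs_le]; constructor <;> linarith
  obtain ⟨u, hu, n, hn⟩ := hreal
  set k := ⌊v.im / Real.pi⌋ with hk
  obtain ⟨m, hm⟩ : ∃ m : ℤ, (-1 : ℝ) ^ k = m := by
    rcases Int.even_or_odd k with h | h
    · exact ⟨1, by simp [h.neg_one_zpow]⟩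
    · exact ⟨-1, by simp [h.neg_one_zpow]⟩
  refine ⟨u + (k * Real.pi : ℝ) * I, ?_, n * m, ?_⟩
  · rw [mem_ball_iff_norm]
    refine (Complex.norm_le_abs_re_add_abs_im _).trans_lt ?_
    have h1 := Int.floor_le (v.im / Real.pi)
    have h2 := Int.lt_floor_add_one (v.im / Real.pi)
    rw [le_div_iff₀ Real.pi_pos] at h1
    rw [div_lt_iff₀ Real.pi_pos] at h2
    have him : |k * Real.pi - v.im| ≤ Real.pi := by
      rw [abs_le]; constructor <;> nlinarith [Real.pi_pos]
    have := Real.pi_lt_four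
    simp
    linarith
  · rw [Complex.cosh_add, Complex.cosh_mul_I, Complex.sinh_mul_I, ← Complex.ofReal_cos,
      ← Complex.ofReal_sin, Real.sin_int_mul_pi, Real.cos_int_mul_pi, ← Complex.ofReal_cosh, hn, hm]
    simp

lemma norm_sinh_le (a : ℂ) : ‖Complex.sinh a‖ ≤ ‖Complex.cosh a‖ + 1 := by
  have h : ‖Complex.sinh a‖ ^ 2 ≤ ‖Complex.cosh a‖ ^ 2 + 1 := by
    rw [← norm_pow, ← norm_pow, Complex.sinh_sq]
    exact (norm_sub_le _ _).trans_eq (by rw [norm_one])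
  nlinarith [norm_nonneg (Complex.sinh a), norm_nonneg (Complex.cosh a)]

lemma norm_cosh_add_le (a b : ℂ) :
    ‖Complex.cosh (a + b)‖ ≤ (2 * ‖Complex.cosh a‖ + 1) * Real.exp ‖b‖ := by
  have h1 : ‖Complex.exp b‖ ≤ Real.exp ‖b‖ := Complex.norm_exp_le_exp_norm b
  have h2 : ‖Complex.exp (-b)‖ ≤ Real.exp ‖b‖ := by
    simpa using Complex.norm_exp_le_exp_norm (-b)
  have hc : ‖Complex.cosh b‖ ≤ Real.exp ‖b‖ := by
    rw [Complex.cosh, norm_div, Complex.norm_two]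
    linarith [norm_add_le (Complex.exp b) (Complex.exp (-b))]
  have hs : ‖Complex.sinh b‖ ≤ Real.exp ‖b‖ := by
    rw [Complex.sinh, norm_div, Complex.norm_two]
    linarith [norm_sub_le (Complex.exp b) (Complex.exp (-b))]
  rw [Complex.cosh_add]
  calc _ ≤ ‖Complex.cosh a‖ * ‖Complex.cosh b‖ + ‖Complex.sinh a‖ * ‖Complex.sinh b‖ := by
        simpa using norm_add_le (Complex.cosh a * Complex.cosh b) (Complex.sinh a * Complex.sinh b)
    _ ≤ ‖Complex.cosh a‖ * Real.exp ‖b‖ + (‖Complex.cosh a‖ + 1) * Real.exp ‖b‖ := by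
        gcongr
        exact norm_sinh_le a
    _ = _ := by ring

/-- **Schottky's theorem**, in the following form: if `φ` is a holomorphic function on a disc
omitting the values `0` and `1`, then the values of `log |φ|` on the concentric disc of half the
radius are comparable. -/
theorem exists_schottky_bound : ∃ K : ℝ, 0 < K ∧ ∀ (φ : ℂ → ℂ) (c : ℂ) (R : ℝ),
    DifferentiableOn ℂ φ (Metric.ball c R) → (∀ z ∈ Metric.ball c R, φ z ≠ 0) →
    (∀ z ∈ Metric.ball c R, φ z ≠ 1) →
    ∀ x ∈ Metric.ball c (R / 2), ∀ y ∈ Metric.ball c (R / 2),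
      |Real.log ‖φ y‖| ≤ K * (1 + |Real.log ‖φ x‖|) := by
  set E := Real.exp (192 * 6) with hE
  refine ⟨12 * Real.pi * E, by positivity, fun φ c R hφ h0 h1 x hx y hy => ?_⟩
  have hR : 0 < R := by
    have := Metric.pos_of_mem_ball hx
    linarith
  have hsub : Metric.ball c (R / 2) ⊆ Metric.ball c R := Metric.ball_subset_ball (by linarith)
  obtain ⟨L, hLd, hLx, hL⟩ := exists_exp_eq_of_ne_zero hφ h0 (hsub hx)
  have hpi : (2 * Real.pi * I : ℂ) ≠ 0 := Complex.two_pi_I_ne_zero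
  set H : ℂ → ℂ := fun z => L z / (2 * Real.pi * I) with hH
  have hLH : ∀ z, L z = H z * (2 * Real.pi * I) := fun z => by rw [hH]; field_simp
  have hHd : DifferentiableOn ℂ H (Metric.ball c R) := hLd.div_const _
  have hHint : ∀ z ∈ Metric.ball c R, ∀ n : ℤ, H z ≠ n := fun z hz n hn => by
    apply h1 z hz
    rw [← hL z hz, hLH, hn, Complex.exp_int_mul_two_pi_mul_I]
  have hsq : ∀ z ∈ Metric.ball c R, H z ^ 2 - 1 ≠ 0 := fun z hz hz0 => by
    have : (H z - 1) * (H z + 1) = 0 := by rw [← hz0]; ring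
    rcases mul_eq_zero.1 this with h | h
    · exact hHint z hz 1 (by push_cast; linear_combination h)
    · exact hHint z hz (-1) (by push_cast; linear_combination h)
  obtain ⟨P, hPd, -, hP⟩ := exists_exp_eq_of_ne_zero ((hHd.pow 2).sub_const 1) hsq (hsub hx)
  set q : ℂ → ℂ := fun z => Complex.exp (P z / 2) with hq
  have hqd : DifferentiableOn ℂ q (Metric.ball c R) := (hPd.div_const 2).cexp
  have hprod : ∀ z ∈ Metric.ball c R, (H z + q z) * (H z - q z) = 1 := fun z hz => by
    have : q z ^ 2 = H z ^ 2 - 1 := by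
      rw [hq, ← Complex.exp_nat_mul, show H z ^ 2 - 1 = _ from (hP z hz).symm]
      congr 1; push_cast; ring
    linear_combination -this
  obtain ⟨V, hVd, -, hV⟩ := exists_exp_eq_of_ne_zero (hHd.add hqd)
    (fun z hz => left_ne_zero_of_mul_eq_one (hprod z hz)) (hsub hx)
  have hcosh : ∀ z ∈ Metric.ball c R, Complex.cosh (V z) = H z := fun z hz => by
    rw [Complex.cosh, Complex.exp_neg, hV z hz]
    simp only [Pi.add_apply]
    rw [inv_eq_of_mul_eq_one_right (hprod z hz)]
    ring
  have hno : ∀ v, ¬ Metric.ball v 6 ⊆ V '' Metric.ball c R := fun v hv => by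
    obtain ⟨w, hw, n, hn⟩ := exists_cosh_eq_intCast_dist_lt v
    obtain ⟨z, hz, rfl⟩ := hv hw
    exact hHint z hz n (by rw [← hcosh z hz, hn])
  have hosc := norm_sub_le_of_forall_ball_not_subset (by norm_num) hVd hno hy hx
  have hHy : ‖H y‖ ≤ (2 * ‖H x‖ + 1) * E := by
    rw [← hcosh y (hsub hy), ← hcosh x (hsub hx)]
    have := norm_cosh_add_le (V x) (V y - V x)
    rw [add_sub_cancel] at this
    exact this.trans (by rw [hE]; gcongr)
  have hLn : ∀ z, ‖L z‖ = ‖H z‖ * (2 * Real.pi) := fun z => by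
    rw [hLH, norm_mul, norm_mul, norm_mul]
    simp [abs_of_pos Real.pi_pos]
  have hre : |Real.log ‖φ y‖| ≤ ‖L y‖ := by
    rw [← hL y (hsub hy), Complex.norm_exp, Real.log_exp]
    exact Complex.abs_re_le_norm _
  have hLxn : ‖L x‖ ≤ |Real.log ‖φ x‖| + Real.pi := by
    rw [hLx]
    refine (Complex.norm_le_abs_re_add_abs_im _).trans ?_
    rw [Complex.log_re, Complex.log_im]
    gcongr
    exact Complex.abs_arg_le_pi _
  have hp3 := Real.pi_gt_three
  have hE0 : 0 < E := Real.exp_pos _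
  calc |Real.log ‖φ y‖| ≤ ‖H y‖ * (2 * Real.pi) := hre.trans (hLn y).le
    _ ≤ (2 * ‖H x‖ + 1) * E * (2 * Real.pi) := by gcongr
    _ = (2 * ‖L x‖ + 2 * Real.pi) * E := by rw [hLn]; ring
    _ ≤ (2 * (|Real.log ‖φ x‖| + Real.pi) + 2 * Real.pi) * E := by gcongr
    _ ≤ 12 * Real.pi * (1 + |Real.log ‖φ x‖|) * E := by
        gcongr
        nlinarith [abs_nonneg (Real.log ‖φ x‖)]
    _ = _ := by ring

/-! ### Growth and covering properties of transcendental self-maps of the punctured plane -/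

namespace IsTranscendentalSelfMapCStar

variable {f : ℂ → ℂ}

lemma inv (hf : IsTranscendentalSelfMapCStar f) :
    IsTranscendentalSelfMapCStar (fun z => (f z)⁻¹) := by
  obtain ⟨m, g, h, hg, hh, hgc, hhc, hfz⟩ := hf
  refine ⟨-m, -g, -h, hg.neg, hh.neg, fun ⟨c, hc⟩ => hgc ⟨-c, fun z => ?_⟩,
    fun ⟨c, hc⟩ => hhc ⟨-c, fun z => ?_⟩, fun z hz => ?_⟩
  · simp [← hc z]
  · simp [← hc z]
  · simp only [hfz z hz, Pi.neg_apply, mul_inv, zpow_neg, ← Complex.exp_neg, neg_add]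

lemma comp_inv (hf : IsTranscendentalSelfMapCStar f) :
    IsTranscendentalSelfMapCStar (fun z => f z⁻¹) := by
  obtain ⟨m, g, h, hg, hh, hgc, hhc, hfz⟩ := hf
  refine ⟨-m, h, g, hh, hg, hhc, hgc, fun z hz => ?_⟩
  change f z⁻¹ = _
  rw [hfz _ (inv_ne_zero hz), inv_inv, inv_zpow', add_comm]

lemma ne_zero (hf : IsTranscendentalSelfMapCStar f) {z : ℂ} (hz : z ≠ 0) : f z ≠ 0 := by
  obtain ⟨m, g, h, -, -, -, -, hfz⟩ := hf
  rw [hfz z hz]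
  exact mul_ne_zero (zpow_ne_zero _ hz) (Complex.exp_ne_zero _)

lemma differentiableAt (hf : IsTranscendentalSelfMapCStar f) {z : ℂ} (hz : z ≠ 0) :
    DifferentiableAt ℂ f z := by
  obtain ⟨m, g, h, hg, hh, -, -, hfz⟩ := hf
  have h1 : DifferentiableAt ℂ (fun z => z ^ m * Complex.exp (g z + h z⁻¹)) z := by
    refine DifferentiableAt.mul (differentiableAt_zpow.2 (Or.inl hz)) ?_
    exact ((hg z).add ((hh z⁻¹).comp z (differentiableAt_inv hz))).cexp
  refine h1.congr_of_eventuallyEq ?_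
  filter_upwards [isOpen_ne.mem_nhds hz] with w hw using hfz w hw

end IsTranscendentalSelfMapCStar

/-- The real part of a nonconstant entire function grows at least linearly. -/
lemma exists_linear_le_re {g : ℂ → ℂ} (hg : Differentiable ℂ g) (hgc : ¬ ∃ c : ℂ, ∀ z, g z = c) :
    ∃ a > 0, ∃ R > 0, ∀ r ≥ R, ∃ z, ‖z‖ = r ∧ (g 0).re + a * r ≤ (g z).re := by
  obtain ⟨z₁, hz₁⟩ : ∃ z, g z ≠ g 0 := by
    by_contra! h
    exact hgc ⟨_, h⟩
  have hρ : 0 < ‖z₁‖ := norm_pos_iff.2 fun h => hz₁ (by rw [h])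
  have hG : 0 < ‖g z₁ - g 0‖ := norm_pos_iff.2 (sub_ne_zero.2 hz₁)
  refine ⟨‖g z₁ - g 0‖ / (8 * ‖z₁‖), by positivity, 2 * ‖z₁‖, by positivity, fun r hr => ?_⟩
  set a := ‖g z₁ - g 0‖ / (8 * ‖z₁‖) with ha
  have ha0 : 0 < a := by positivity
  have hr0 : 0 < r := by linarith
  by_contra! hlt
  have hmaps : MapsTo (fun z => g z - g 0) (Metric.ball 0 r) {z | z.re ≤ a * r} := by
    intro z hz
    have hb := Complex.norm_le_of_forall_mem_frontier_norm_le (f := fun z => Complex.exp (g z - g 0))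
      (U := Metric.ball 0 r) (C := Real.exp (a * r)) Metric.isBounded_ball
      ((hg.sub_const _).cexp.diffContOnCl) (fun w hw => by
        rw [frontier_ball _ hr0.ne', mem_sphere_zero_iff_norm] at hw
        rw [Complex.norm_exp, Real.exp_le_exp, Complex.sub_re]
        linarith [hlt w hw]) (subset_closure hz)
    rw [Complex.norm_exp, Real.exp_le_exp] at hb
    exact hb
  have hz₁r : z₁ ∈ Metric.ball 0 r := by
    rw [mem_ball_zero_iff]; linarith
  have hbc := Complex.borelCaratheodory_zero (by positivity) (hg.sub_const (g 0)).differentiableOn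
    hmaps hr0 hz₁r (sub_self _)
  rw [le_div_iff₀ (by linarith)] at hbc
  have h8 : ‖g z₁ - g 0‖ = a * (8 * ‖z₁‖) := by rw [ha]; field_simp
  rw [h8] at hbc
  nlinarith [mul_pos ha0 hρ]

lemma IsTranscendentalSelfMapCStar.exists_le_log_norm {f : ℂ → ℂ}
    (hf : IsTranscendentalSelfMapCStar f) (K : ℝ) :
    ∃ s₀, ∀ s ≥ s₀, ∃ z, z ≠ 0 ∧ Real.log ‖z‖ = s ∧ K * (1 + s) ≤ Real.log ‖f z‖ := by
  obtain ⟨m, g, h, hg, hh, hgc, -, hfz⟩ := hf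
  obtain ⟨a, ha, R, hR, hgrow⟩ := exists_linear_le_re hg hgc
  obtain ⟨B, hB⟩ := (isCompact_closedBall (0 : ℂ) 1).exists_bound_of_continuousOn
    hh.continuous.continuousOn
  have hB0 : 0 ≤ B := (norm_nonneg _).trans (hB 0 (Metric.mem_closedBall_self zero_le_one))
  set C := |(m : ℝ)| + |K| + B + |(g 0).re| with hC
  refine ⟨max 1 (max (Real.log R) (4 * C / a)), fun s hs => ?_⟩
  have hs1 : 1 ≤ s := (le_max_left _ _).trans hs
  have hsR : Real.log R ≤ s := (le_max_left _ _).trans ((le_max_right _ _).trans hs)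
  have hsC : 4 * C / a ≤ s := (le_max_right _ _).trans ((le_max_right _ _).trans hs)
  rw [div_le_iff₀ ha] at hsC
  obtain ⟨z, hz, hzre⟩ := hgrow (Real.exp s) (by
    rw [Real.log_le_iff_le_exp hR] at hsR; exact hsR)
  have hz0 : z ≠ 0 := norm_pos_iff.1 (hz ▸ Real.exp_pos s)
  have hlog : Real.log ‖z‖ = s := by rw [hz, Real.log_exp]
  refine ⟨z, hz0, hlog, ?_⟩
  have hfl : Real.log ‖f z‖ = m * s + ((g z).re + (h z⁻¹).re) := by
    rw [hfz z hz0, norm_mul, norm_zpow, Complex.norm_exp,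
      Real.log_mul (zpow_ne_zero _ (norm_ne_zero_iff.2 hz0)) (Real.exp_ne_zero _), Real.log_zpow,
      hlog, Real.log_exp, Complex.add_re]
  have hhB : -B ≤ (h z⁻¹).re := by
    have h1 := hB z⁻¹ (by
      rw [mem_closedBall_zero_iff, norm_inv, hz]
      exact inv_le_one_of_one_le₀ (Real.one_le_exp (by linarith)))
    linarith [neg_abs_le (h z⁻¹).re, Complex.abs_re_le_norm (h z⁻¹)]
  have hexp := Real.quadratic_le_exp_of_nonneg (show 0 ≤ s by linarith)
  have h1 : a * (s ^ 2 / 2) ≤ a * Real.exp s := by gcongr; nlinarith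
  have h2 : 2 * C * s ≤ a * (s ^ 2 / 2) := by nlinarith
  have h3 : -|(m : ℝ)| * s ≤ m * s := by gcongr; exact neg_abs_le _
  have h4 : K * (1 + s) ≤ |K| * (1 + s) := by gcongr; exact le_abs_self _
  have h5 := neg_abs_le (g 0).re
  have h6 : (|K| + B + |(g 0).re|) * (1 + s) ≤ (|K| + B + |(g 0).re|) * (2 * s) := by
    gcongr; linarith
  have h7 : B + |(g 0).re| ≤ (B + |(g 0).re|) * (1 + s) :=
    le_mul_of_one_le_right (by positivity) (by linarith)
  have h8 := mul_nonneg (abs_nonneg (m : ℝ)) (show 0 ≤ s by linarith)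
  rw [hfl]
  rw [hC] at h2
  linarith

/-- A closed round annulus, described in logarithmic coordinates. -/
def logAnnulus (s : ℝ) : Set ℂ := {z | z ≠ 0 ∧ |Real.log ‖z‖ - s| ≤ 8}

lemma IsTranscendentalSelfMapCStar.exists_mem_logAnnulus_of_le {f : ℂ → ℂ}
    (hf : IsTranscendentalSelfMapCStar f) :
    ∃ s₀, ∀ s ≥ s₀, ∀ a ≠ 0, |Real.log ‖a‖| ≤ s + 20 → ∃ z ∈ logAnnulus s, f z = a := by
  obtain ⟨K, hK, hsch⟩ := exists_schottky_bound
  obtain ⟨s₁, hs₁⟩ := hf.exists_le_log_norm (K + 21)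
  obtain ⟨s₂, hs₂⟩ := hf.inv.exists_le_log_norm (K + 21)
  refine ⟨max 0 (max s₁ s₂), fun s hs a ha hal => ?_⟩
  have hs0 : 0 ≤ s := (le_max_left _ _).trans hs
  obtain ⟨p, hp0, hps, hp⟩ := hs₁ s ((le_max_left _ _).trans ((le_max_right _ _).trans hs))
  obtain ⟨q, hq0, hqs, hq⟩ := hs₂ s ((le_max_right _ _).trans ((le_max_right _ _).trans hs))
  rw [norm_inv, Real.log_inv] at hq
  rw [abs_le] at hal
  by_contra! hno
  set φ : ℂ → ℂ := fun w => f (Complex.exp w) / a with hφ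
  have hlogφ : ∀ w, Real.log ‖φ w‖ = Real.log ‖f (Complex.exp w)‖ - Real.log ‖a‖ := fun w => by
    rw [hφ, norm_div, Real.log_div (norm_ne_zero_iff.2 (hf.ne_zero (Complex.exp_ne_zero w)))
      (norm_ne_zero_iff.2 ha)]
  have hφd : Differentiable ℂ φ := fun w =>
    ((hf.differentiableAt (Complex.exp_ne_zero w)).comp w Complex.differentiableAt_exp).div_const a
  have hφ0 : ∀ w, φ w ≠ 0 := fun w => div_ne_zero (hf.ne_zero (Complex.exp_ne_zero w)) ha
  have hφ1 : ∀ w ∈ Metric.ball (s : ℂ) 8, φ w ≠ 1 := fun w hw h => by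
    refine hno (Complex.exp w) ⟨Complex.exp_ne_zero w, ?_⟩ ((div_eq_one_iff_eq ha).1 h)
    rw [Complex.norm_exp, Real.log_exp]
    rw [mem_ball_iff_norm] at hw
    have := Complex.abs_re_le_norm (w - s)
    rw [Complex.sub_re, Complex.ofReal_re] at this
    linarith
  have hlogmem : ∀ u : ℂ, u ≠ 0 → Real.log ‖u‖ = s →
      Complex.log u ∈ Metric.ball (s : ℂ) (8 / 2) := fun u hu hus => by
    rw [mem_ball_iff_norm]
    have h1 : Complex.log u - s = (Complex.arg u : ℂ) * I := by
      rw [Complex.log, hus]; ring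
    rw [h1, norm_mul, Complex.norm_I, Complex.norm_real, mul_one, Real.norm_eq_abs]
    linarith [Complex.abs_arg_le_pi u, Real.pi_lt_four]
  have hpm := hlogmem p hp0 hps
  have hqm := hlogmem q hq0 hqs
  have hKs : 0 ≤ K * s := by positivity
  have hcont : Continuous fun w => Real.log ‖φ w‖ :=
    hφd.continuous.norm.log fun w => norm_ne_zero_iff.2 (hφ0 w)
  have hlp := hlogφ (Complex.log p)
  have hlq := hlogφ (Complex.log q)
  rw [Complex.exp_log hp0] at hlp
  rw [Complex.exp_log hq0] at hlq
  obtain ⟨x, hx, hx0⟩ := (convex_ball (s : ℂ) (8 / 2)).isPreconnected.intermediate_value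
    hqm hpm hcont.continuousOn (show (0 : ℝ) ∈ Icc _ _ by
      constructor
      · rw [hlq]; linarith
      · rw [hlp]; linarith)
  have := hsch φ s 8 hφd.differentiableOn (fun w _ => hφ0 w) hφ1 x hx _ hpm
  rw [show Real.log ‖φ x‖ = 0 from hx0, abs_zero, add_zero, mul_one] at this
  have := (le_abs_self _).trans this
  rw [hlp] at this
  linarith

/-- Annuli close to the essential singularities cover much larger annuli. -/
lemma IsTranscendentalSelfMapCStar.exists_mem_logAnnulus {f : ℂ → ℂ}
    (hf : IsTranscendentalSelfMapCStar f) :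
    ∃ s₀ ≥ 0, ∀ s, s₀ ≤ |s| → ∀ a ≠ 0, |Real.log ‖a‖| ≤ |s| + 20 →
      ∃ z ∈ logAnnulus s, f z = a := by
  obtain ⟨s₁, h₁⟩ := hf.exists_mem_logAnnulus_of_le
  obtain ⟨s₂, h₂⟩ := hf.comp_inv.exists_mem_logAnnulus_of_le
  refine ⟨max 0 (max s₁ s₂), le_max_left _ _, fun s hs a ha hal => ?_⟩
  have hs₁ : s₁ ≤ |s| := (le_max_left _ _).trans ((le_max_right _ _).trans hs)
  have hs₂ : s₂ ≤ |s| := (le_max_right _ _).trans ((le_max_right _ _).trans hs)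
  rcases abs_choice s with h | h
  · rw [h] at hs₁ hal
    exact h₁ s hs₁ a ha hal
  · rw [h] at hs₂ hal
    obtain ⟨z, ⟨hz0, hz⟩, hza⟩ := h₂ (-s) hs₂ a ha hal
    refine ⟨z⁻¹, ⟨inv_ne_zero hz0, ?_⟩, hza⟩
    rw [norm_inv, Real.log_inv, ← abs_neg]
    convert hz using 2
    ring

lemma logAnnulus_eq_image (s : ℝ) :
    logAnnulus s = Complex.exp '' (Icc (s - 8) (s + 8) ×ℂ Icc (-Real.pi) Real.pi) := by
  ext z
  constructor
  · rintro ⟨hz0, hz⟩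
    rw [abs_le] at hz
    refine ⟨Complex.log z, ?_, Complex.exp_log hz0⟩
    rw [Complex.mem_reProdIm, Complex.log_re, Complex.log_im]
    exact ⟨⟨by linarith, by linarith⟩, (Complex.neg_pi_lt_arg z).le, Complex.arg_le_pi z⟩
  · rintro ⟨w, hw, rfl⟩
    obtain ⟨⟨h1, h2⟩, -⟩ := Complex.mem_reProdIm.1 hw
    refine ⟨Complex.exp_ne_zero w, ?_⟩
    rw [Complex.norm_exp, Real.log_exp, abs_le]
    constructor <;> linarith

lemma isCompact_logAnnulus (s : ℝ) : IsCompact (logAnnulus s) := by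
  rw [logAnnulus_eq_image]
  exact (isCompact_Icc.reProdIm isCompact_Icc).image Complex.continuous_exp

lemma isPreconnected_logAnnulus (s : ℝ) : IsPreconnected (logAnnulus s) := by
  rw [logAnnulus_eq_image]
  exact (((convex_Icc _ _).linear_preimage Complex.reLm).inter
    ((convex_Icc _ _).linear_preimage Complex.imLm)).isPreconnected.image _
    Complex.continuous_exp.continuousOn

lemma abs_log_norm_le_of_mem_logAnnulus {s : ℝ} {z : ℂ} (hz : z ∈ logAnnulus s) :
    |Real.log ‖z‖| ≤ |s| + 8 := by
  have h1 := hz.2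
  have h2 := abs_add_le (Real.log ‖z‖ - s) s
  rw [sub_add_cancel] at h2
  linarith

/-! ### Points with the blow-up property -/

/-- The set of points of the punctured plane with the blow-up property: for every neighbourhood,
any two points of the punctured plane belong to a common forward image of it. -/
def blowUpSet (f : ℂ → ℂ) : Set ℂ :=
  {z | z ≠ 0 ∧ ∀ U ∈ 𝓝 z, ∀ w₁ ≠ 0, ∀ w₂ ≠ 0,
    ∃ n : ℕ, w₁ ∈ f^[n] '' (U \ {0}) ∧ w₂ ∈ f^[n] '' (U \ {0})}

lemma isOpen_compl_blowUpSet (f : ℂ → ℂ) : IsOpen {z | z ≠ 0 ∧ z ∉ blowUpSet f} := by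
  rw [isOpen_iff_mem_nhds]
  rintro z ⟨hz0, hz⟩
  rw [blowUpSet, mem_ofPred_eq] at hz
  push Not at hz
  obtain ⟨U, hU, w₁, hw₁, w₂, hw₂, h⟩ := hz hz0
  filter_upwards [isOpen_ne.mem_nhds hz0, eventually_mem_nhds_iff.2 hU] with y hy0 hyU
  refine ⟨hy0, fun hy => ?_⟩
  obtain ⟨n, h1, h2⟩ := hy.2 U hyU w₁ hw₁ w₂ hw₂
  exact h n h1 h2

namespace IsTranscendentalSelfMapCStar

variable {f : ℂ → ℂ}

lemma iterate_ne_zero (hf : IsTranscendentalSelfMapCStar f) (n : ℕ) {z : ℂ} (hz : z ≠ 0) :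
    f^[n] z ≠ 0 := by
  induction n with
  | zero => exact hz
  | succ n ih => rw [iterate_succ_apply']; exact hf.ne_zero ih

lemma differentiableAt_iterate (hf : IsTranscendentalSelfMapCStar f) (n : ℕ) {z : ℂ}
    (hz : z ≠ 0) : DifferentiableAt ℂ f^[n] z := by
  induction n with
  | zero => exact differentiableAt_id
  | succ n ih =>
    rw [iterate_succ']
    exact (hf.differentiableAt (hf.iterate_ne_zero n hz)).comp z ih

lemma isOpen_image (hf : IsTranscendentalSelfMapCStar f) {V : Set ℂ} (hV : IsOpen V)
    (h0 : V ⊆ {0}ᶜ) : IsOpen (f '' V) := by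
  have han : AnalyticOnNhd ℂ f {0}ᶜ := DifferentiableOn.analyticOnNhd
    (fun z hz => (hf.differentiableAt hz).differentiableWithinAt) isOpen_compl_singleton
  have hconn : IsPreconnected ({0}ᶜ : Set ℂ) :=
    (isConnected_compl_singleton_of_one_lt_rank (by simp) 0).isPreconnected
  rcases han.is_constant_or_isOpen hconn with ⟨w, hw⟩ | h
  · obtain ⟨s₀, hs₀, hcov⟩ := hf.exists_mem_logAnnulus
    have hs : s₀ ≤ |s₀| := le_abs_self _
    obtain ⟨x, hx, hx1⟩ := hcov s₀ hs 1 one_ne_zero (by simp; positivity)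
    obtain ⟨y, hy, hy1⟩ := hcov s₀ hs (-1) (by simp) (by simp; positivity)
    have h1 : f x = f y := (hw x hx.1).trans (hw y hy.1).symm
    rw [hx1, hy1] at h1
    norm_num at h1
  · exact h V h0 hV

lemma mem_blowUpSet_of_map_mem (hf : IsTranscendentalSelfMapCStar f) {z : ℂ} (hz : z ≠ 0)
    (h : f z ∈ blowUpSet f) : z ∈ blowUpSet f := by
  refine ⟨hz, fun U hU w₁ hw₁ w₂ hw₂ => ?_⟩
  have hV : IsOpen (interior U \ {0}) := isOpen_interior.sdiff isClosed_singleton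
  have hopen := hf.isOpen_image hV fun x hx => hx.2
  obtain ⟨n, h1, h2⟩ := h.2 _ (hopen.mem_nhds ⟨z, ⟨mem_interior_iff_mem_nhds.2 hU, hz⟩, rfl⟩)
    w₁ hw₁ w₂ hw₂
  have hsub : f^[n] '' (f '' (interior U \ {0}) \ {0}) ⊆ f^[n + 1] '' (U \ {0}) := by
    rintro _ ⟨_, ⟨⟨u, hu, rfl⟩, -⟩, rfl⟩
    exact ⟨u, ⟨interior_subset hu.1, hu.2⟩, iterate_succ_apply f n u⟩
  exact ⟨n + 1, hsub h1, hsub h2⟩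

/-- If a disc does not have the blow-up property, then the functions `log |fⁿ|` have comparable
values near its centre, uniformly in `n`. -/
lemma eventually_abs_log_norm_iterate_le (hf : IsTranscendentalSelfMapCStar f) {z : ℂ}
    (hz : z ≠ 0) (h : z ∉ blowUpSet f) :
    ∃ C, 0 ≤ C ∧ ∃ V ∈ 𝓝 z, ∀ x ∈ V, ∀ y ∈ V, ∀ n : ℕ,
      |Real.log ‖f^[n] y‖| ≤ C * (1 + |Real.log ‖f^[n] x‖|) := by
  obtain ⟨K, hK, hsch⟩ := exists_schottky_bound
  rw [blowUpSet, mem_ofPred_eq] at h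
  push Not at h
  obtain ⟨U, hU, w₁, hw₁, w₂, hw₂, h⟩ := h hz
  obtain ⟨R, hR, hRU⟩ := Metric.mem_nhds_iff.1 (inter_mem hU (isOpen_ne.mem_nhds hz))
  set l := max |Real.log ‖w₁‖| |Real.log ‖w₂‖| with hl
  have hl0 : 0 ≤ l := (abs_nonneg _).trans (le_max_left _ _)
  refine ⟨l + K + K * l, by positivity, Metric.ball z (R / 2),
    Metric.ball_mem_nhds z (half_pos hR), fun x hx y hy n => ?_⟩
  have hball : Metric.ball z (R / 2) ⊆ Metric.ball z R := Metric.ball_subset_ball (by linarith)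
  obtain ⟨a, ha0, hal, hano⟩ : ∃ a ≠ 0, |Real.log ‖a‖| ≤ l ∧ a ∉ f^[n] '' (U \ {0}) := by
    by_cases h1 : w₁ ∈ f^[n] '' (U \ {0})
    · exact ⟨w₂, hw₂, le_max_right _ _, h n h1⟩
    · exact ⟨w₁, hw₁, le_max_left _ _, h1⟩
  have key := hsch (fun w => f^[n] w / a) z R
    (fun w hw => ((hf.differentiableAt_iterate n (hRU hw).2).div_const a).differentiableWithinAt)
    (fun w hw => div_ne_zero (hf.iterate_ne_zero n (hRU hw).2) ha0)
    (fun w hw h1 => hano ⟨w, ⟨(hRU hw).1, (hRU hw).2⟩, (div_eq_one_iff_eq ha0).1 h1⟩) x hx y hy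
  have hlog : ∀ w ∈ Metric.ball z (R / 2), Real.log ‖f^[n] w / a‖ =
      Real.log ‖f^[n] w‖ - Real.log ‖a‖ := fun w hw => by
    rw [norm_div, Real.log_div
      (norm_ne_zero_iff.2 (hf.iterate_ne_zero n (hRU (hball hw)).2)) (norm_ne_zero_iff.2 ha0)]
  rw [hlog x hx, hlog y hy] at key
  have h1 := abs_sub (Real.log ‖f^[n] x‖) (Real.log ‖a‖)
  have h2 := abs_add_le (Real.log ‖f^[n] y‖ - Real.log ‖a‖) (Real.log ‖a‖)
  rw [sub_add_cancel] at h2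
  set X := |Real.log ‖f^[n] x‖|
  have hX : 0 ≤ X := abs_nonneg _
  have h3 : K * (1 + |Real.log ‖f^[n] x‖ - Real.log ‖a‖|) ≤ K * (1 + (X + l)) := by
    gcongr; linarith
  have h4 : 0 ≤ (l + K * l) * X := by positivity
  linarith

/-- Iterates of an annulus cover arbitrarily large annuli. -/
lemma exists_iterate_succ_eq {s₀ : ℝ}
    (hcov : ∀ s, s₀ ≤ |s| → ∀ a ≠ 0, |Real.log ‖a‖| ≤ |s| + 20 → ∃ z ∈ logAnnulus s, f z = a)
    (n : ℕ) : ∀ s, s₀ ≤ |s| → ∀ a ≠ 0, |Real.log ‖a‖| ≤ |s| + n →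
      ∃ z ∈ logAnnulus s, f^[n + 1] z = a := by
  induction n with
  | zero =>
    intro s hs a ha hal
    rw [Nat.cast_zero, add_zero] at hal
    exact hcov s hs a ha (by linarith)
  | succ n ih =>
    intro s hs a ha hal
    have habs : |(|s| + 1)| = |s| + 1 := abs_of_pos (by positivity)
    obtain ⟨y, hy, hya⟩ := ih (|s| + 1) (by rw [habs]; linarith) a ha (by
      rw [habs]; push_cast at hal; linarith)
    have hy1 := abs_log_norm_le_of_mem_logAnnulus hy
    rw [habs] at hy1
    obtain ⟨z, hz, hzy⟩ := hcov s hs y hy.1 (by linarith)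
    exact ⟨z, hz, by rw [iterate_succ_apply, hzy, hya]⟩

lemma exists_mem_blowUpSet (hf : IsTranscendentalSelfMapCStar f) {s₀ : ℝ}
    (hcov : ∀ s, s₀ ≤ |s| → ∀ a ≠ 0, |Real.log ‖a‖| ≤ |s| + 20 → ∃ z ∈ logAnnulus s, f z = a)
    {s : ℝ} (hs : s₀ ≤ |s|) : ∃ z ∈ logAnnulus s, z ∈ blowUpSet f := by
  by_contra! hno
  set T : ℕ → ℂ → ℝ := fun n x => |Real.log ‖f^[n] x‖| with hT
  have hT0 : ∀ n x, 0 ≤ T n x := fun n x => abs_nonneg _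
  set Q : ℝ → ℂ → ℂ → Prop := fun C x y =>
    ∀ n, T n y ≤ C * (1 + T n x) ∧ T n x ≤ C * (1 + T n y) with hQ
  have hloc : ∀ z ∈ logAnnulus s, ∃ C, 0 ≤ C ∧ ∃ V ∈ 𝓝 z, ∀ x ∈ V, ∀ y ∈ V, Q C x y := by
    intro z hz
    obtain ⟨C, hC, V, hV, h⟩ := hf.eventually_abs_log_norm_iterate_le hz.1 (hno z hz)
    exact ⟨C, hC, V, hV, fun x hx y hy n => ⟨h x hx y hy n, h y hy x hx n⟩⟩
  have haux : ∀ {C C' a b c : ℝ}, 0 ≤ C → 0 ≤ C' → 0 ≤ a → b ≤ C * (1 + a) →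
      c ≤ C' * (1 + b) → c ≤ (C' * (1 + C)) * (1 + a) := by
    intro C C' a b c hC hC' ha hb hc
    calc c ≤ C' * (1 + b) := hc
      _ ≤ C' * (1 + C * (1 + a)) := by gcongr
      _ ≤ C' * ((1 + a) + C * (1 + a)) := by gcongr; linarith
      _ = _ := by ring
  have htrans : ∀ {C C' x y z}, 0 ≤ C → 0 ≤ C' → Q C x y → Q C' y z →
      Q (C' * (1 + C) + C * (1 + C')) x z := by
    intro C C' x y z hC hC' h h' n
    have h1 := haux hC hC' (hT0 n x) (h n).1 (h' n).1
    have h2 := haux hC' hC (hT0 n z) (h' n).2 (h n).2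
    have h3 : 0 ≤ C * (1 + C') * (1 + T n x) := by have := hT0 n x; positivity
    have h4 : 0 ≤ C' * (1 + C) * (1 + T n z) := by have := hT0 n z; positivity
    constructor <;> linarith
  have hconn : ∀ x ∈ logAnnulus s, ∀ y ∈ logAnnulus s, ∃ C, 0 ≤ C ∧ Q C x y := by
    intro x hx y hy
    refine (isPreconnected_logAnnulus s).induction₂ (fun x y => ∃ C, 0 ≤ C ∧ Q C x y) ?_ ?_ ?_ hx hy
    · intro z hz
      obtain ⟨C, hC, V, hV, h⟩ := hloc z hz
      filter_upwards [mem_nhdsWithin_of_mem_nhds hV] with w hw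
      exact ⟨C, hC, h z (mem_of_mem_nhds hV) w hw⟩
    · rintro a b c - - - ⟨C, hC, h⟩ ⟨C', hC', h'⟩
      exact ⟨_, by positivity, htrans hC hC' h h'⟩
    · rintro a b - - ⟨C, hC, h⟩
      exact ⟨C, hC, fun n => (h n).symm⟩
  obtain ⟨x₀, hx₀, -⟩ := hcov s hs 1 one_ne_zero (by simp; positivity)
  obtain ⟨C, hC, hunif⟩ : ∃ C, 0 ≤ C ∧ ∀ x ∈ logAnnulus s, Q C x₀ x := by
    refine (isCompact_logAnnulus s).induction_on (p := fun S => ∃ C, 0 ≤ C ∧ ∀ x ∈ S, Q C x₀ x)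
      ⟨0, le_rfl, by simp⟩ ?_ ?_ ?_
    · rintro S S' hSS ⟨C, hC, h⟩
      exact ⟨C, hC, fun x hx => h x (hSS hx)⟩
    · rintro S S' ⟨C, hC, h⟩ ⟨C', hC', h'⟩
      refine ⟨max C C', le_max_of_le_left hC, fun x hx n => ?_⟩
      have h1 := hT0 n x
      have h2 := hT0 n x₀
      rcases hx with hx | hx
      · refine ⟨(h x hx n).1.trans ?_, (h x hx n).2.trans ?_⟩ <;> gcongr <;> exact le_max_left _ _
      · refine ⟨(h' x hx n).1.trans ?_, (h' x hx n).2.trans ?_⟩ <;> gcongr <;>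
          exact le_max_right _ _
    · intro z hz
      obtain ⟨C, hC, h⟩ := hconn x₀ hx₀ z hz
      obtain ⟨C', hC', V, hV, h'⟩ := hloc z hz
      exact ⟨V, mem_nhdsWithin_of_mem_nhds hV, _, by positivity,
        fun x hx => htrans hC hC' h (h' z (mem_of_mem_nhds hV) x hx)⟩
  obtain ⟨n, hn⟩ := exists_nat_gt (C * (1 + C))
  obtain ⟨x, hx, hx1⟩ := exists_iterate_succ_eq hcov n s hs 1 one_ne_zero (by simp; positivity)
  have hle : (0 : ℝ) ≤ |s| + n := by positivity
  obtain ⟨y, hy, hy1⟩ := exists_iterate_succ_eq hcov n s hs (Complex.exp ((|s| + n : ℝ) : ℂ))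
    (Complex.exp_ne_zero _) (by
      rw [Complex.norm_exp, Real.log_exp, Complex.ofReal_re, abs_of_nonneg hle])
  have hTx : T (n + 1) x = 0 := by simp only [hT, hx1]; simp
  have hTy : T (n + 1) y = |s| + n := by
    simp only [hT, hy1]
    rw [Complex.norm_exp, Real.log_exp, Complex.ofReal_re, abs_of_nonneg hle]
  have h1 := (hunif x hx (n + 1)).2
  have h2 := (hunif y hy (n + 1)).1
  rw [hTx, add_zero, mul_one] at h1
  rw [hTy] at h2
  have h3 : C * (1 + T (n + 1) x₀) ≤ C * (1 + C) := by gcongr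
  linarith [abs_nonneg s]

/-- The little escaping set contains points with the blow-up property. -/
lemma exists_mem_littleEscapingSet_blowUpSet (hf : IsTranscendentalSelfMapCStar f)
    (e : ℕ → Bool) : ∃ z ∈ littleEscapingSet f e, z ∈ blowUpSet f := by
  obtain ⟨s₀, hs₀, hcov⟩ := hf.exists_mem_logAnnulus
  set s : ℕ → ℝ := fun n => if e n = true then s₀ + 9 + n else -(s₀ + 9 + n) with hs
  have hsabs : ∀ n, |s n| = s₀ + 9 + n := fun n => by
    have : 0 ≤ s₀ + 9 + n := by positivity
    simp only [hs]
    split_ifs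
    · exact abs_of_nonneg this
    · rw [abs_neg, abs_of_nonneg this]
  have hsle : ∀ n, s₀ ≤ |s n| := fun n => by
    rw [hsabs]; linarith [Nat.cast_nonneg (α := ℝ) n]
  have hfin : ∀ n m : ℕ, ∃ z ∈ blowUpSet f, ∀ j ≤ n, f^[j] z ∈ logAnnulus (s (m + j)) := by
    intro n
    induction n with
    | zero =>
      intro m
      obtain ⟨z, hz, hzJ⟩ := hf.exists_mem_blowUpSet hcov (hsle m)
      exact ⟨z, hzJ, fun j hj => by rw [Nat.le_zero.1 hj]; exact hz⟩
    | succ n ih =>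
      intro m
      obtain ⟨y, hyJ, hy⟩ := ih (m + 1)
      have hy0 : y ∈ logAnnulus (s (m + 1)) := hy 0 n.zero_le
      have hyn := abs_log_norm_le_of_mem_logAnnulus hy0
      obtain ⟨z, hz, rfl⟩ := hcov (s m) (hsle m) y hy0.1 (by
        rw [hsabs] at hyn ⊢; push_cast at hyn; linarith)
      refine ⟨z, hf.mem_blowUpSet_of_map_mem hz.1 hyJ, fun j hj => ?_⟩
      cases j with
      | zero => exact hz
      | succ j =>
        have := hy j (Nat.le_of_succ_le_succ hj)
        rwa [add_assoc, add_comm 1 j] at this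
  have hcpt : IsCompact (logAnnulus (s 0) \ {z | z ≠ 0 ∧ z ∉ blowUpSet f}) :=
    (isCompact_logAnnulus _).diff (isOpen_compl_blowUpSet f)
  obtain ⟨z, hz, hzj⟩ := hcpt.inter_iInter_nonempty
    (fun j => logAnnulus (s 0) ∩ f^[j] ⁻¹' logAnnulus (s j))
    (fun j => ContinuousOn.preimage_isClosed_of_isClosed
      (fun w hw => (hf.differentiableAt_iterate j hw.1).continuousAt.continuousWithinAt)
      (isCompact_logAnnulus _).isClosed (isCompact_logAnnulus _).isClosed)
    (fun u => by
      obtain ⟨z, hzJ, hz⟩ := hfin (u.sup id) 0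
      simp only [zero_add] at hz
      have hz0 := hz 0 (Nat.zero_le _)
      exact ⟨z, ⟨hz0, fun h => h.2 hzJ⟩,
        mem_iInter₂.2 fun j hj => ⟨hz0, hz j (Finset.le_sup (f := id) hj)⟩⟩)
  have hmem : ∀ j, f^[j] z ∈ logAnnulus (s j) := fun j => (mem_iInter.1 hzj j).2
  have hz0 : z ≠ 0 := hz.1.1
  have hzJ : z ∈ blowUpSet f := by
    by_contra h
    exact hz.2 ⟨hz0, h⟩
  have hpos : ∀ j, e j = true → (j : ℝ) + 1 ≤ Real.log ‖f^[j] z‖ := fun j hj => by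
    have := (abs_le.1 (hmem j).2).1
    simp only [hs, hj, if_true] at this
    linarith
  have hneg : ∀ j, e j ≠ true → Real.log ‖f^[j] z‖ ≤ -((j : ℝ) + 1) := fun j hj => by
    have := (abs_le.1 (hmem j).2).2
    simp only [hs, if_neg hj] at this
    linarith
  have hnpos : ∀ j, 0 < ‖f^[j] z‖ := fun j => norm_pos_iff.2 (hmem j).1
  refine ⟨z, ⟨⟨hz0, fun ε hε => ?_⟩, 0, 0, fun n => ?_⟩, hzJ⟩
  · obtain ⟨N, hN⟩ := exists_nat_gt (-Real.log ε)
    refine ⟨N, fun n hn => ?_⟩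
    have hNn : (N : ℝ) ≤ n := by exact_mod_cast hn
    by_cases h : e n = true
    · right
      rw [← Real.log_lt_log_iff (by positivity) (hnpos n), one_div, Real.log_inv]
      linarith [hpos n h]
    · left
      rw [← Real.log_lt_log_iff (hnpos n) hε]
      linarith [hneg n h]
  · rw [add_zero, ← Real.log_pos_iff (hnpos n).le]
    have hn0 : (0 : ℝ) ≤ n := n.cast_nonneg
    constructor
    · intro h
      by_contra h'
      linarith [hneg n h']
    · intro h
      linarith [hpos n h]

/-- The little escaping set is backward invariant. -/
lemma mem_littleEscapingSet_of_iterate_mem {e : ℕ → Bool} {z : ℂ} (hz : z ≠ 0) {m : ℕ}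
    (h : f^[m] z ∈ littleEscapingSet f e) : z ∈ littleEscapingSet f e := by
  obtain ⟨⟨-, hesc⟩, ℓ, k, hlk⟩ := h
  refine ⟨⟨hz, fun ε hε => ?_⟩, ℓ + m, k, fun n => ?_⟩
  · obtain ⟨N, hN⟩ := hesc ε hε
    refine ⟨N + m, fun n hn => ?_⟩
    have := hN (n - m) (by omega)
    rwa [← iterate_add_apply, Nat.sub_add_cancel (by omega)] at this
  · rw [← hlk n, ← iterate_add_apply, add_assoc]

/-- The little escaping set is forward invariant. -/
lemma iterate_mem_littleEscapingSet (hf : IsTranscendentalSelfMapCStar f) {e : ℕ → Bool} {z : ℂ}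
    (m : ℕ) (h : z ∈ littleEscapingSet f e) : f^[m] z ∈ littleEscapingSet f e := by
  obtain ⟨⟨hz, hesc⟩, ℓ, k, hlk⟩ := h
  refine ⟨⟨hf.iterate_ne_zero m hz, fun ε hε => ?_⟩, ℓ, k + m, fun n => ?_⟩
  · obtain ⟨N, hN⟩ := hesc ε hε
    refine ⟨N, fun n hn => ?_⟩
    rw [← iterate_add_apply]
    exact hN (n + m) (by omega)
  · rw [← iterate_add_apply, ← add_assoc, add_right_comm n k m, ← hlk (n + m), add_right_comm]

end IsTranscendentalSelfMapCStar

/-- For a transcendental self-map `f` of `ℂ*` and any essential itinerary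
`e ∈ {0,∞}^ℕ` (encoded with `true = ∞`, `false = 0`), the little escaping set `I_e(f)` is
either connected or has infinitely many connected components. -/
theorem littleEscapingSet_connected_or_infinite_components (f : ℂ → ℂ)
    (hf : IsTranscendentalSelfMapCStar f) (e : ℕ → Bool) :
    IsConnected (littleEscapingSet f e) ∨
      Infinite (ConnectedComponents ↥(littleEscapingSet f e)) := by
  rw [or_iff_not_imp_right, not_infinite_iff_finite]
  intro hfinite
  obtain ⟨z, hzS, hzJ⟩ := hf.exists_mem_littleEscapingSet_blowUpSet e
  refine ⟨⟨z, hzS⟩, isPreconnected_of_forall_pair fun w₁ hw₁ w₂ hw₂ => ?_⟩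
  have hopen : IsOpen (connectedComponent (⟨z, hzS⟩ : littleEscapingSet f e)) := by
    rw [← connectedComponents_preimage_singleton]
    exact (isOpen_discrete _).preimage ConnectedComponents.continuous_coe
  obtain ⟨U, hU, hUC⟩ := isOpen_induced_iff.1 hopen
  have hzU : z ∈ U := by
    have : (⟨z, hzS⟩ : littleEscapingSet f e) ∈ Subtype.val ⁻¹' U := by
      rw [hUC]
      exact mem_connectedComponent
    exact this
  obtain ⟨n, ⟨u₁, hu₁, rfl⟩, ⟨u₂, hu₂, rfl⟩⟩ :=
    hzJ.2 U (hU.mem_nhds hzU) w₁ hw₁.1.1 w₂ hw₂.1.1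
  have hmem : ∀ u ∈ U \ {0}, f^[n] u ∈ littleEscapingSet f e →
      u ∈ Subtype.val '' connectedComponent (⟨z, hzS⟩ : littleEscapingSet f e) := fun u hu hun => by
    have huS := IsTranscendentalSelfMapCStar.mem_littleEscapingSet_of_iterate_mem hu.2 hun
    refine ⟨⟨u, huS⟩, ?_, rfl⟩
    rw [← hUC]
    exact hu.1
  have hsub : Subtype.val '' connectedComponent (⟨z, hzS⟩ : littleEscapingSet f e) ⊆
      littleEscapingSet f e := by
    rintro _ ⟨x, -, rfl⟩
    exact x.2
  refine ⟨f^[n] '' (Subtype.val '' connectedComponent (⟨z, hzS⟩ : littleEscapingSet f e)), ?_,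
    mem_image_of_mem _ (hmem u₁ hu₁ hw₁), mem_image_of_mem _ (hmem u₂ hu₂ hw₂), ?_⟩
  · rintro _ ⟨x, hx, rfl⟩
    exact hf.iterate_mem_littleEscapingSet n (hsub hx)
  · exact (isPreconnected_connectedComponent.image _ continuous_subtype_val.continuousOn).image _
      fun x hx => (hf.differentiableAt_iterate n (hsub hx).1.1).continuousAt.continuousWithinAt
end
end
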